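/- Suppose there exists a real constant C₃ such that for all sufficiently small ε > 0 one has (1/2)∫_Ω (|∇u_ε|² + |∇v_ε|²) dx ≤ C₃ ≤ (1/2)∫_Ω (|∇u₀|² + |∇v₀|²) dx. Then C₃ = (1/2)∫_Ω (|∇u₀|² + |∇v₀|²) dx, and (u_ε, v_ε) → (u₀, v₀) in H¹(Ω) × H¹(Ω) as ε → 0⁺, i.e., ∫_Ω |u_ε − u₀|² dx → 0, ∫_Ω |∇u_ε − ∇u₀|² dx → 0, ∫_Ω |v_ε − v₀|² dx → 0 and ∫_Ω |∇v_ε − ∇v₀|² dx → 0. -/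

import Mathlib

open MeasureTheory Filter Topology

noncomputable section

/-- Points of the plane, viewed as the Euclidean space `ℝ²`. -/
abbrev Pt : Type := EuclideanSpace ℝ (Fin 2)

/-- The `i`-th partial derivative of a complex-valued function. -/
def pd (u : Pt → ℂ) (x : Pt) (i : Fin 2) : ℂ :=
  fderiv ℝ u x (EuclideanSpace.single i 1)

/-- Squared Hilbert–Schmidt norm of the derivative, `|∇u|²`. -/
def gradSq (u : Pt → ℂ) (x : Pt) : ℝ :=
  ∑ i, ‖pd u x i‖ ^ 2

/-- `|∇u − ∇v|²`. -/
def gradDiffSq (u v : Pt → ℂ) (x : Pt) : ℝ :=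
  ∑ i, ‖pd u x i - pd v x i‖ ^ 2

/-- Laplacian of a complex-valued function. -/
def lap (u : Pt → ℂ) (x : Pt) : ℂ :=
  ∑ i, fderiv ℝ (fun y => pd u y i) x (EuclideanSpace.single i 1)

/-- The `i`-th partial derivative of a real-valued function. -/
def pdR (f : Pt → ℝ) (x : Pt) (i : Fin 2) : ℝ :=
  fderiv ℝ f x (EuclideanSpace.single i 1)

/-- `|∇f|²` for a real-valued function `f`. -/
def gradSqR (f : Pt → ℝ) (x : Pt) : ℝ :=
  ∑ i, (pdR f x i) ^ 2

/-- Laplacian of a real-valued function. -/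
def lapR (f : Pt → ℝ) (x : Pt) : ℝ :=
  ∑ i, fderiv ℝ (fun y => pdR f y i) x (EuclideanSpace.single i 1)

/-- The zeros of a real function at which its derivative does not vanish form a countable set. -/
theorem countable_zero_deriv_ne_zero (f f' : ℝ → ℝ) :
    {t : ℝ | f t = 0 ∧ f' t ≠ 0 ∧ HasDerivAt f (f' t) t}.Countable := by
  set S := {t : ℝ | f t = 0 ∧ f' t ≠ 0 ∧ HasDerivAt f (f' t) t} with hS
  refine Set.Countable.mono ?_ (countable_setOfPred_isolated_right_within (s := S))
  intro t ht
  refine ⟨ht, ?_⟩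
  have h1 : ∀ᶠ z in 𝓝[≠] t, f z ≠ 0 := ht.2.2.eventually_ne ht.2.1
  have h2 : ∀ᶠ z in 𝓝[S ∩ Set.Ioi t] t, f z ≠ 0 :=
    h1.filter_mono (nhdsWithin_mono _ fun z hz => ne_of_gt hz.2)
  have h3 : ∀ᶠ z in 𝓝[S ∩ Set.Ioi t] t, z ∈ S ∩ Set.Ioi t := self_mem_nhdsWithin
  rw [← eventually_false_iff_eq_bot]
  filter_upwards [h2, h3] with z hz hzS using hz hzS.1.1

/-- Partial derivatives vanish almost everywhere on the zero set. -/
theorem ae_pdR_eq_zero_of_eq_zero {Ω : Set Pt} (hΩ : IsOpen Ω) {h : Pt → ℝ}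
    (hh : DifferentiableOn ℝ h Ω) (i : Fin 2) :
    ∀ᵐ x, x ∈ Ω → h x = 0 → pdR h x i = 0 := by
  set e : Pt := EuclideanSpace.single i 1 with he
  let L : ℝ →L[ℝ] Pt := ContinuousLinearMap.toSpanSingleton ℝ e
  have hmeas : MeasurableSet {x | x ∈ Ω → h x = 0 → pdR h x i = 0} := by
    have h1 : MeasurableSet (Ω ∩ h ⁻¹' {0}ᶜ) :=
      (hh.continuousOn.isOpen_inter_preimage hΩ isOpen_compl_singleton).measurableSet
    have h2 : MeasurableSet {x | pdR h x i = 0} :=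
      (measurable_fderiv_apply_const ℝ h e) (measurableSet_singleton 0)
    have : {x | x ∈ Ω → h x = 0 → pdR h x i = 0}
        = (Ωᶜ ∪ (Ω ∩ h ⁻¹' {0}ᶜ)) ∪ {x | pdR h x i = 0} := by
      ext x
      simp only [Set.mem_ofPred_eq, Set.mem_union, Set.mem_compl_iff, Set.mem_inter_iff,
        Set.mem_preimage, Set.mem_singleton_iff]
      tauto
    rw [this]
    exact (hΩ.measurableSet.compl.union h1).union h2
  refine ae_mem_of_ae_add_linearMap_mem L.toLinearMap (volume : Measure ℝ) volume hmeas fun y => ?_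
  have hc := (countable_zero_deriv_ne_zero (fun t => h (y + L t))
    (fun t => pdR h (y + L t) i)).measure_zero volume
  filter_upwards [measure_eq_zero_iff_ae_notMem.1 hc] with t ht hΩt hzero
  by_contra hne
  refine ht ⟨hzero, hne, ?_⟩
  have h1 : HasFDerivAt h (fderiv ℝ h (y + L t)) (y + L t) :=
    (hh.differentiableAt (hΩ.mem_nhds hΩt)).hasFDerivAt
  have h2 : HasDerivAt (fun t => y + L t) e t := by
    have := (L.hasFDerivAt (x := t)).hasDerivAt.const_add y
    simpa [L] using this
  exact h1.comp_hasDerivAt t h2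

theorem integral_mul_le_half {X : Type*} [MeasurableSpace X] {μ : Measure X} {f g : X → ℝ}
    (hf : MemLp f 2 μ) (hg : MemLp g 2 μ) {s : ℝ} (hs : 0 < s) :
    |∫ x, f x * g x ∂μ| ≤ s / 2 * ∫ x, f x ^ 2 ∂μ + s⁻¹ / 2 * ∫ x, g x ^ 2 ∂μ := by
  rw [← integral_const_mul, ← integral_const_mul,
    ← integral_add (hf.integrable_sq.const_mul _) (hg.integrable_sq.const_mul _)]
  refine (abs_integral_le_integral_abs).trans (integral_mono (hf.integrable_mul hg).abs
    ((hf.integrable_sq.const_mul _).add (hg.integrable_sq.const_mul _)) fun x => ?_)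
  have h1 : 0 ≤ s⁻¹ / 2 * (s * |f x| - |g x|) ^ 2 := by positivity
  have h2 : s⁻¹ / 2 * (s * |f x| - |g x|) ^ 2
      = s / 2 * f x ^ 2 + s⁻¹ / 2 * g x ^ 2 - |f x * g x| := by
    rw [abs_mul, ← sq_abs (f x), ← sq_abs (g x)]
    field_simp
    ring
  simp only
  linarith

/-- Sequential weak compactness of bounded sets of `L²`, in terms of functions. -/
theorem exists_weak_limit (f : ℕ → Pt → ℝ) (hf : ∀ n, MemLp (f n) 2 volume) (C : ℝ)
    (hC : ∀ n, ∫ x, f n x ^ 2 ≤ C) :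
    ∃ A : Pt → ℝ, MemLp A 2 volume ∧ ∃ σ : ℕ → ℕ, StrictMono σ ∧
      ∀ g : Pt → ℝ, MemLp g 2 volume →
        Tendsto (fun n => ∫ x, g x * f (σ n) x) atTop (𝓝 (∫ x, g x * A x)) := by
  have inner_eq : ∀ (a b : Pt → ℝ) (ha : MemLp a 2 volume) (hb : MemLp b 2 volume),
      inner ℝ (ha.toLp a) (hb.toLp b) = ∫ x, b x * a x := fun a b ha hb => by
    rw [L2.inner_def]
    refine integral_congr_ae ?_
    filter_upwards [ha.coeFn_toLp, hb.coeFn_toLp] with x h1 h2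
    rw [h1, h2]
    simp
  have : Fact ((2 : ENNReal) ≠ ⊤) := ⟨by norm_num⟩
  let J := InnerProductSpace.toDual ℝ (Lp ℝ 2 (volume : Measure Pt))
  have hb : ∀ n, (StrongDual.toWeakDual (J ((hf n).toLp (f n)))) ∈
      WeakDual.toStrongDual ⁻¹' Metric.closedBall (0 : StrongDual ℝ (Lp ℝ 2 (volume : Measure Pt)))
        (√C) := fun n => by
    simp only [Set.mem_preimage, Metric.mem_closedBall, dist_zero_right]
    change ‖J ((hf n).toLp (f n))‖ ≤ _
    rw [LinearIsometryEquiv.norm_map]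
    apply Real.le_sqrt_of_sq_le
    rw [← real_inner_self_eq_norm_sq, inner_eq]
    refine le_trans (le_of_eq ?_) (hC n)
    simp [sq]
  obtain ⟨a, -, σ, hσ, ha⟩ := WeakDual.isSeqCompact_closedBall ℝ
    (Lp ℝ 2 (volume : Measure Pt)) 0 (√C) hb
  let A := J.symm (WeakDual.toStrongDual a)
  refine ⟨A, Lp.memLp A, σ, hσ, fun g hg => ?_⟩
  have h1 := ((WeakDual.eval_continuous (hg.toLp g)).tendsto a).comp ha
  have h2 : a (hg.toLp g) = ∫ x, g x * A x := by
    rw [← inner_eq _ _ (Lp.memLp A) hg, Lp.toLp_coeFn]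
    change _ = J A _
    simp [A]
  rw [← h2]
  refine h1.congr fun n => ?_
  exact inner_eq _ _ (hf (σ n)) hg

/-- Weak convergence in `L²`. -/
def WeakLim (f : ℕ → Pt → ℝ) (A : Pt → ℝ) : Prop :=
  ∀ g : Pt → ℝ, MemLp g 2 volume → Tendsto (fun n => ∫ x, g x * f n x) atTop (𝓝 (∫ x, g x * A x))

theorem WeakLim.comp {f : ℕ → Pt → ℝ} {A : Pt → ℝ} (h : WeakLim f A) {σ : ℕ → ℕ}
    (hσ : StrictMono σ) : WeakLim (fun n => f (σ n)) A :=
  fun g hg => (h g hg).comp hσ.tendsto_atTop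

theorem tendsto_integral_mul_mul_zero {X ι : Type*} [MeasurableSpace X] {μ : Measure X}
    {l : Filter ι} {k : X → ℝ} {f g : ι → X → ℝ} {M C : ℝ}
    (hk : AEStronglyMeasurable k μ) (hM : ∀ x, |k x| ≤ M)
    (hf : ∀ n, MemLp (f n) 2 μ) (hg : ∀ n, MemLp (g n) 2 μ)
    (hf0 : Tendsto (fun n => ∫ x, f n x ^ 2 ∂μ) l (𝓝 0)) (hC : ∀ᶠ n in l, ∫ x, g n x ^ 2 ∂μ ≤ C) :
    Tendsto (fun n => ∫ x, k x * f n x * g n x ∂μ) l (𝓝 0) := by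
  have hkg : ∀ n, MemLp (fun x => k x * g n x) 2 μ := fun n =>
    (hg n).of_le_mul (c := M) (hk.mul (hg n).1) (ae_of_all _ fun x => by
      rw [norm_mul]; exact mul_le_mul_of_nonneg_right (hM x) (norm_nonneg _))
  have hkgC : ∀ᶠ n in l, ∫ x, (k x * g n x) ^ 2 ∂μ ≤ M ^ 2 * C := hC.mono fun n hn => by
    refine le_trans ?_ (mul_le_mul_of_nonneg_left hn (sq_nonneg M))
    rw [← integral_const_mul]
    refine integral_mono (hkg n).integrable_sq ((hg n).integrable_sq.const_mul _) fun x => ?_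
    simp only [mul_pow]
    exact mul_le_mul_of_nonneg_right (sq_le_sq' (by linarith [abs_le.1 (hM x)])
      (abs_le.1 (hM x)).2) (sq_nonneg _)
  rw [Metric.tendsto_nhds]
  intro η hη
  set K := M ^ 2 * C with hK
  have hs : 0 < (|K| + 1) / η := by positivity
  have hsmall : ∀ᶠ n in l, ∫ x, f n x ^ 2 ∂μ < η / ((|K| + 1) / η) :=
    hf0.eventually_lt_const (by positivity)
  filter_upwards [hsmall, hkgC] with n h1 h2
  rw [Real.dist_eq, sub_zero]
  have h3 := integral_mul_le_half (hf n) (hkg n) hs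
  have h4 : ∫ x, k x * f n x * g n x ∂μ = ∫ x, f n x * (k x * g n x) ∂μ := by
    congr 1; ext x; ring
  rw [h4]
  refine h3.trans_lt ?_
  have h5 : (|K| + 1) / η / 2 * ∫ x, f n x ^ 2 ∂μ < η / 2 := by
    calc _ < (|K| + 1) / η / 2 * (η / ((|K| + 1) / η)) := by gcongr
      _ = η / 2 := by field_simp
  have h6 : ((|K| + 1) / η)⁻¹ / 2 * ∫ x, (k x * g n x) ^ 2 ∂μ ≤ η / 2 := by
    calc _ ≤ ((|K| + 1) / η)⁻¹ / 2 * (|K| + 1) := by gcongr; linarith [le_abs_self K]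
      _ = η / 2 := by field_simp
  linarith

theorem WeakLim.tendsto_mul {f g : ℕ → Pt → ℝ} {f₀ g₀ k : Pt → ℝ} {M C : ℝ}
    (hk : AEStronglyMeasurable k volume) (hM : ∀ x, |k x| ≤ M)
    (hf : ∀ n, MemLp (f n) 2 volume) (hf₀ : MemLp f₀ 2 volume) (hg : ∀ n, MemLp (g n) 2 volume)
    (hff : Tendsto (fun n => ∫ x, (f n x - f₀ x) ^ 2) atTop (𝓝 0))
    (hC : ∀ n, ∫ x, g n x ^ 2 ≤ C) (hgg : WeakLim g g₀) :
    Tendsto (fun n => ∫ x, k x * f n x * g n x) atTop (𝓝 (∫ x, k x * f₀ x * g₀ x)) := by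
  have hkf : ∀ {f : Pt → ℝ}, MemLp f 2 volume → MemLp (fun x => k x * f x) 2 volume := fun hf =>
    hf.of_le_mul (c := M) (hk.mul hf.1) (ae_of_all _ fun x => by
      rw [norm_mul]; exact mul_le_mul_of_nonneg_right (hM x) (norm_nonneg _))
  have h1 := tendsto_integral_mul_mul_zero (l := atTop) hk hM (fun n => (hf n).sub hf₀) hg hff
    (Eventually.of_forall hC)
  have h2 := hgg _ (hkf hf₀)
  have h3 := h1.add h2
  rw [zero_add] at h3
  refine h3.congr fun n => ?_
  have e1 : Integrable (fun x => k x * (f n x - f₀ x) * g n x) :=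
    (hkf ((hf n).sub hf₀)).integrable_mul (hg n)
  have e2 : Integrable (fun x => k x * f₀ x * g n x) := (hkf hf₀).integrable_mul (hg n)
  simp only [Pi.sub_apply]
  rw [← integral_add e1 e2]
  congr 1; ext x; ring

/-- Twice continuously differentiable functions with compact support in `Ω`. -/
structure IsTest (Ω : Set Pt) (h : Pt → ℝ) : Prop where
  contDiff : ContDiff ℝ 2 h
  compact : HasCompactSupport h
  subset : tsupport h ⊆ Ω

namespace IsTest
variable {Ω : Set Pt} {h k : Pt → ℝ}

theorem continuous (hh : IsTest Ω h) : Continuous h := hh.contDiff.continuous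

theorem differentiable (hh : IsTest Ω h) : Differentiable ℝ h :=
  hh.contDiff.differentiable (by norm_num)

theorem contDiff_pdR (hh : IsTest Ω h) (i : Fin 2) : ContDiff ℝ 1 (fun x => pdR h x i) :=
  (hh.contDiff.fderiv_right (m := 1) (by norm_num)).clm_apply contDiff_const

theorem continuous_pdR (hh : IsTest Ω h) (i : Fin 2) : Continuous (fun x => pdR h x i) :=
  (hh.contDiff_pdR i).continuous

theorem compact_pdR (hh : IsTest Ω h) (i : Fin 2) : HasCompactSupport (fun x => pdR h x i) :=
  hh.compact.fderiv_apply ℝ _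

theorem memLp (hh : IsTest Ω h) : MemLp h 2 volume :=
  hh.continuous.memLp_of_hasCompactSupport hh.compact

theorem memLp_pdR (hh : IsTest Ω h) (i : Fin 2) : MemLp (fun x => pdR h x i) 2 volume :=
  (hh.continuous_pdR i).memLp_of_hasCompactSupport (hh.compact_pdR i)

theorem integrable_gradSqR (hh : IsTest Ω h) : Integrable (gradSqR h) :=
  integrable_finsetSum _ fun i _ => (hh.memLp_pdR i).integrable_sq

theorem pdR_sub (hh : IsTest Ω h) (hk : IsTest Ω k) (x : Pt) (i : Fin 2) :
    pdR (fun x => h x - k x) x i = pdR h x i - pdR k x i := by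
  unfold pdR
  rw [fderiv_fun_sub (hh.differentiable x) (hk.differentiable x)]
  rfl

theorem sub (hh : IsTest Ω h) (hk : IsTest Ω k) : IsTest Ω (fun x => h x - k x) := by
  have hs : tsupport (fun x => h x - k x) ⊆ tsupport h ∪ tsupport k := tsupport_sub h k
  refine ⟨hh.contDiff.sub hk.contDiff, ?_, hs.trans (Set.union_subset hh.subset hk.subset)⟩
  exact (hh.compact.isCompact.union hk.compact.isCompact).of_isClosed_subset
    (isClosed_tsupport _) hs

theorem eq_zero (hh : IsTest Ω h) {x : Pt} (hx : x ∉ Ω) : h x = 0 :=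
  image_eq_zero_of_notMem_tsupport fun h' => hx (hh.subset h')

end IsTest

theorem gradSqR_nonneg (h : Pt → ℝ) (x : Pt) : 0 ≤ gradSqR h x :=
  Finset.sum_nonneg fun _ _ => sq_nonneg _

theorem fderiv_apply_sq_le (h : Pt → ℝ) (x z : Pt) :
    (fderiv ℝ h x z) ^ 2 ≤ ‖z‖ ^ 2 * gradSqR h x := by
  have hz : z = ∑ i, z i • (EuclideanSpace.single i (1 : ℝ) : Pt) := by
    ext j
    fin_cases j <;> simp
  have h1 : fderiv ℝ h x z = ∑ i, z i * pdR h x i := by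
    conv_lhs => rw [hz]
    simp [pdR]
  rw [h1, EuclideanSpace.norm_sq_eq]
  simp only [Real.norm_eq_abs, sq_abs]
  exact Finset.sum_mul_sq_le_sq_mul_sq _ _ _

theorem sq_intervalIntegral_le {g : ℝ → ℝ} (hg : Continuous g) :
    (∫ t in (0 : ℝ)..1, g t) ^ 2 ≤ ∫ t in (0 : ℝ)..1, g t ^ 2 := by
  set c := ∫ t in (0 : ℝ)..1, g t with hc
  have h0 : 0 ≤ ∫ t in (0 : ℝ)..1, (g t - c) ^ 2 :=
    intervalIntegral.integral_nonneg (by norm_num) fun t _ => sq_nonneg _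
  have h1 : ∫ t in (0 : ℝ)..1, (g t - c) ^ 2
      = (∫ t in (0 : ℝ)..1, g t ^ 2) - 2 * c * c + c ^ 2 := by
    have : ∀ t, (g t - c) ^ 2 = g t ^ 2 - 2 * c * g t + c ^ 2 := fun t => by ring
    simp only [this]
    rw [intervalIntegral.integral_add, intervalIntegral.integral_sub,
      intervalIntegral.integral_const_mul, ← hc]
    · simp
    all_goals exact Continuous.intervalIntegrable (by fun_prop) _ _
  nlinarith

/-- `L²` modulus of continuity of a test function under translation. -/
theorem integral_translate_sub_sq_le {Ω : Set Pt} {h : Pt → ℝ} (hh : IsTest Ω h) (z : Pt) :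
    ∫ x, (h (x + z) - h x) ^ 2 ≤ ‖z‖ ^ 2 * ∫ x, gradSqR h x := by
  have hcf : Continuous (fderiv ℝ h) := hh.contDiff.continuous_fderiv (by norm_num)
  have hcg : Continuous (gradSqR h) :=
    continuous_finsetSum _ fun i _ => (hh.continuous_pdR i).pow 2
  have hpt : ∀ x, (h (x + z) - h x) ^ 2 ≤ ‖z‖ ^ 2 * ∫ t in (0 : ℝ)..1, gradSqR h (x + t • z) := by
    intro x
    have hd : ∀ t : ℝ, HasDerivAt (fun t : ℝ => h (x + t • z)) (fderiv ℝ h (x + t • z) z) t := by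
      intro t
      have h1 : HasDerivAt (fun t : ℝ => x + t • z) z t := by
        simpa using ((hasDerivAt_id t).smul_const z).const_add x
      exact (hh.differentiable _).hasFDerivAt.comp_hasDerivAt t h1
    have hc : Continuous fun t : ℝ => fderiv ℝ h (x + t • z) z := by fun_prop
    have h2 := intervalIntegral.integral_eq_sub_of_hasDerivAt (a := 0) (b := 1)
      (fun t _ => hd t) (hc.intervalIntegrable _ _)
    simp only [one_smul, zero_smul, add_zero] at h2
    rw [← h2, ← intervalIntegral.integral_const_mul]
    refine (sq_intervalIntegral_le hc).trans (intervalIntegral.integral_mono_on (by norm_num)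
      (Continuous.intervalIntegrable (by fun_prop) _ _)
      (Continuous.intervalIntegrable (by fun_prop) _ _) fun t _ => fderiv_apply_sq_le _ _ _)
  have hint : Integrable (Function.uncurry fun (t : ℝ) (x : Pt) => gradSqR h (x + t • z))
      ((volume.restrict (Set.Ioc (0 : ℝ) 1)).prod volume) := by
    rw [integrable_prod_iff (by
      refine Continuous.aestronglyMeasurable ?_
      simp only [Function.uncurry_def]
      fun_prop)]
    have hti : ∀ t : ℝ, Integrable (fun x => gradSqR h (x + t • z)) := fun t =>
      hh.integrable_gradSqR.comp_add_right (t • z)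
    refine ⟨ae_of_all _ hti, ?_⟩
    simp only [Function.uncurry_apply_pair]
    have : ∀ t : ℝ, ∫ x, ‖gradSqR h (x + t • z)‖ = ∫ x, ‖gradSqR h x‖ := fun t =>
      integral_add_right_eq_self (fun x => ‖gradSqR h x‖) (t • z)
    simp only [this]
    exact integrable_const _
  have hswap : ∫ x, ∫ t in (0 : ℝ)..1, gradSqR h (x + t • z) = ∫ x, gradSqR h x := by
    simp only [intervalIntegral.integral_of_le zero_le_one]
    rw [← integral_integral_swap hint]
    simp [integral_add_right_eq_self (gradSqR h)]
  rw [← hswap, ← integral_const_mul]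
  refine integral_mono_of_nonneg (ae_of_all _ fun x => sq_nonneg _) ?_ (ae_of_all _ hpt)
  refine Integrable.const_mul ?_ _
  simp only [intervalIntegral.integral_of_le zero_le_one]
  exact hint.integral_prod_right

theorem integral_sq_sub_integral_mul_translate_le {Ω : Set Pt} {h : Pt → ℝ} (hh : IsTest Ω h)
    (z : Pt) :
    2 * ∫ x, h x ^ 2 ≤ 2 * (∫ x, h x * h (x + z)) + ‖z‖ ^ 2 * ∫ x, gradSqR h x := by
  have hz : MemLp (fun x => h (x + z)) 2 volume :=
    hh.memLp.comp_measurePreserving (measurePreserving_add_right volume z)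
  have h1 := integral_translate_sub_sq_le hh z
  have hm : Integrable (fun x => h x * h (x + z)) := hh.memLp.integrable_mul hz
  have h2 : ∫ x, (h (x + z) - h x) ^ 2
      = (∫ x, h (x + z) ^ 2) - 2 * (∫ x, h x * h (x + z)) + ∫ x, h x ^ 2 := by
    have hs : Integrable (fun x => h (x + z) ^ 2 - 2 * (h x * h (x + z))) :=
      hz.integrable_sq.sub (hm.const_mul 2)
    rw [← integral_const_mul, ← integral_sub hz.integrable_sq
      (hm.const_mul 2), ← integral_add hs hh.memLp.integrable_sq]
    congr 1; ext x; ring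
  rw [h2, integral_add_right_eq_self (fun x => h x ^ 2) z] at h1
  linarith

/-- Poincaré inequality for test functions on a bounded set. -/
theorem exists_poincare {Ω : Set Pt} (hb : Bornology.IsBounded Ω) :
    ∃ C : ℝ, 0 ≤ C ∧ ∀ h, IsTest Ω h → ∫ x, h x ^ 2 ≤ C * ∫ x, gradSqR h x := by
  obtain ⟨R, hR⟩ := hb.subset_ball (0 : Pt)
  set z : Pt := EuclideanSpace.single 0 (2 * |R|) with hz
  have hzn : ‖z‖ = 2 * |R| := by simp [hz]
  refine ⟨‖z‖ ^ 2 / 2, by positivity, fun h hh => ?_⟩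
  have h1 := integral_sq_sub_integral_mul_translate_le hh z
  have h2 : ∫ x, h x * h (x + z) = 0 := by
    refine integral_eq_zero_of_ae (ae_of_all _ fun x => ?_)
    by_cases hx : x ∈ Ω
    · have : x + z ∉ Ω := fun hxz => by
        have a1 := mem_ball_zero_iff.1 (hR hx)
        have a2 := mem_ball_zero_iff.1 (hR hxz)
        have a3 : ‖z‖ ≤ ‖x + z‖ + ‖x‖ := by
          simpa using norm_sub_le (x + z) x
        linarith [le_abs_self R]
      simp [hh.eq_zero this]
    · simp [hh.eq_zero hx]
  rw [h2] at h1
  linarith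

theorem integral_sq_le_smoothed {Ω : Set Pt} {h : Pt → ℝ} (hh : IsTest Ω h)
    (ρ : ContDiffBump (0 : Pt)) :
    ∫ x, h x ^ 2 ≤ (∫ x, h x * ∫ z, ρ.normed volume z * h (x + z))
      + ρ.rOut ^ 2 / 2 * ∫ x, gradSqR h x := by
  set r := ρ.normed volume with hr
  have hrc : Continuous r := ρ.continuous_normed
  have hrs : HasCompactSupport r := ρ.hasCompactSupport_normed
  have hcont : Continuous (Function.uncurry fun (x z : Pt) => h x * (r z * h (x + z))) := by
    have := hh.continuous
    simp only [Function.uncurry_def]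
    fun_prop
  have hcs : HasCompactSupport (Function.uncurry fun (x z : Pt) => h x * (r z * h (x + z))) := by
    refine HasCompactSupport.intro (hh.compact.isCompact.prod hrs.isCompact) fun p hp => ?_
    simp only [Set.mem_prod, not_and_or] at hp
    rcases hp with hp | hp
    · simp [Function.uncurry, image_eq_zero_of_notMem_tsupport hp]
    · simp [Function.uncurry, image_eq_zero_of_notMem_tsupport hp]
  have hswap : ∫ x, h x * ∫ z, r z * h (x + z) = ∫ z, r z * ∫ x, h x * h (x + z) := by
    simp only [← integral_const_mul]
    rw [integral_integral_swap_of_hasCompactSupport hcont hcs]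
    congr 1; ext z; congr 1; ext x; ring
  set D := ∫ x, gradSqR h x with hD
  have hD0 : 0 ≤ D := integral_nonneg (gradSqR_nonneg h)
  have hpt : ∀ z, r z * (∫ x, h x ^ 2)
      ≤ r z * (∫ x, h x * h (x + z)) + r z * (ρ.rOut ^ 2 / 2 * D) := by
    intro z
    by_cases hz : z ∈ Metric.ball (0 : Pt) ρ.rOut
    · have h1 := integral_sq_sub_integral_mul_translate_le hh z
      have h2 : ‖z‖ ^ 2 ≤ ρ.rOut ^ 2 :=
        pow_le_pow_left₀ (norm_nonneg _) (mem_ball_zero_iff.1 hz).le 2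
      have h3 : ‖z‖ ^ 2 * D ≤ ρ.rOut ^ 2 * D := mul_le_mul_of_nonneg_right h2 hD0
      rw [← mul_add]
      exact mul_le_mul_of_nonneg_left (by linarith) (ρ.nonneg_normed z)
    · have : r z = 0 := by
        rw [← Function.notMem_support, hr, ρ.support_normed_eq]
        exact hz
      simp [this]
  have hri : Integrable r := hrc.integrable_of_hasCompactSupport hrs
  have hi : Integrable fun z => r z * ∫ x, h x * h (x + z) := by
    have := (hcont.integrable_of_hasCompactSupport (μ := volume.prod volume) hcs).integral_prod_right
    refine this.congr (ae_of_all _ fun z => ?_)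
    simp only [Function.uncurry, ← integral_const_mul]
    congr 1; ext x; ring
  have h1 : ∫ z, r z * (∫ x, h x ^ 2) ≤
      ∫ z, (r z * (∫ x, h x * h (x + z)) + r z * (ρ.rOut ^ 2 / 2 * D)) :=
    integral_mono (hri.mul_const _) (hi.add (hri.mul_const _)) hpt
  rw [integral_add hi (hri.mul_const _), integral_mul_const, integral_mul_const,
    ρ.integral_normed, one_mul, one_mul] at h1
  rw [hswap]
  exact h1

theorem integral_gradSqR_sub_le {Ω : Set Pt} {h k : Pt → ℝ} (hh : IsTest Ω h) (hk : IsTest Ω k) :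
    ∫ x, gradSqR (fun x => h x - k x) x
      ≤ 2 * (∫ x, gradSqR h x) + 2 * ∫ x, gradSqR k x := by
  rw [← integral_const_mul, ← integral_const_mul,
    ← integral_add (hh.integrable_gradSqR.const_mul _) (hk.integrable_gradSqR.const_mul _)]
  refine integral_mono (hh.sub hk).integrable_gradSqR
    ((hh.integrable_gradSqR.const_mul _).add (hk.integrable_gradSqR.const_mul _)) fun x => ?_
  simp only [gradSqR, hh.pdR_sub hk, Fin.sum_univ_two]
  nlinarith [sq_nonneg (pdR h x 0 + pdR k x 0), sq_nonneg (pdR h x 1 + pdR k x 1)]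

/-- Bounded weakly convergent sequences of test functions are Cauchy in `L²`. -/
theorem cauchy_of_weakLim {Ω : Set Pt} (hb : Bornology.IsBounded Ω)
    {h : ℕ → Pt → ℝ} (hh : ∀ n, IsTest Ω (h n)) {C : ℝ} (hC : ∀ n, ∫ x, gradSqR (h n) x ≤ C)
    {A : Pt → ℝ} (hA : WeakLim h A) {η : ℝ} (hη : 0 < η) :
    ∃ N, ∀ n ≥ N, ∀ m ≥ N, ∫ x, (h n x - h m x) ^ 2 ≤ η := by
  obtain ⟨Cp, hCp0, hCp⟩ := exists_poincare hb
  have hC0 : 0 ≤ C := (integral_nonneg (gradSqR_nonneg (h 0))).trans (hC 0)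
  set t : ℝ := Real.sqrt (η / (8 * (C + 1))) with ht
  have ht0 : 0 < t := Real.sqrt_pos.2 (by positivity)
  have ht2 : t ^ 2 = η / (8 * (C + 1)) := Real.sq_sqrt (by positivity)
  let ρ : ContDiffBump (0 : Pt) := ⟨t / 2, t, by positivity, by linarith⟩
  set r := ρ.normed volume with hr
  have hrc : Continuous r := ρ.continuous_normed
  have hrs : HasCompactSupport r := ρ.hasCompactSupport_normed
  have hrm : MemLp r 2 volume := hrc.memLp_of_hasCompactSupport hrs
  have hrt : ∀ x, MemLp (fun y => r (y - x)) 2 volume := fun x =>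
    hrm.comp_measurePreserving (measurePreserving_sub_right volume x)
  set G : ℕ → Pt → ℝ := fun n x => ∫ z, r z * h n (x + z) with hG
  have hGeq : ∀ n x, G n x = ∫ y, r (y - x) * h n y := fun n x => by
    rw [← integral_add_left_eq_self (fun y => r (y - x) * h n y) x]
    simp [hG]
  have hGm : ∀ n, StronglyMeasurable (G n) := fun n => by
    refine StronglyMeasurable.integral_prod_right'
      (f := fun p : Pt × Pt => r p.2 * h n (p.1 + p.2)) ?_
    have := (hh n).continuous
    exact Continuous.stronglyMeasurable (by fun_prop)
  set G₀ : Pt → ℝ := fun x => ∫ y, r (y - x) * A y with hG₀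
  have hlim : ∀ x, Tendsto (fun n => G n x) atTop (𝓝 (G₀ x)) := fun x => by
    simp only [hGeq]
    exact hA _ (hrt x)
  set M : ℝ := 1 / 2 * (∫ y, r y ^ 2) + 1 / 2 * (Cp * C) with hM
  have hGb : ∀ n x, |G n x| ≤ M := fun n x => by
    have h1 := integral_mul_le_half (hrt x) (hh n).memLp one_pos
    rw [hGeq]
    have h2 : ∫ y, r (y - x) ^ 2 = ∫ y, r y ^ 2 := integral_sub_right_eq_self (fun y => r y ^ 2) x
    rw [h2] at h1
    have h3 := (hCp _ (hh n)).trans (mul_le_mul_of_nonneg_left (hC n) hCp0)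
    norm_num at h1
    linarith
  have hG₀b : ∀ x, |G₀ x| ≤ M := fun x =>
    le_of_tendsto (hlim x).abs (Eventually.of_forall fun n => hGb n x)
  have hG₀m : StronglyMeasurable G₀ := stronglyMeasurable_of_tendsto atTop hGm (tendsto_pi_nhds.2 hlim)
  have : IsFiniteMeasure (volume.restrict Ω) := ⟨by
    rw [Measure.restrict_apply_univ]; exact hb.measure_lt_top⟩
  have hGL : ∀ n, MemLp (G n) 2 (volume.restrict Ω) := fun n =>
    MemLp.of_bound (hGm n).aestronglyMeasurable M (ae_of_all _ (hGb n))
  have hG₀L : MemLp G₀ 2 (volume.restrict Ω) :=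
    MemLp.of_bound hG₀m.aestronglyMeasurable M (ae_of_all _ hG₀b)
  have hdct : Tendsto (fun n => ∫ x in Ω, (G n x - G₀ x) ^ 2) atTop (𝓝 0) := by
    have := tendsto_integral_of_dominated_convergence (μ := volume.restrict Ω)
      (F := fun n x => (G n x - G₀ x) ^ 2) (f := fun _ => 0) (fun _ => (2 * M) ^ 2)
      (fun n => (((hGm n).sub hG₀m).pow 2).aestronglyMeasurable) (integrable_const _)
      (fun n => ae_of_all _ fun x => by
        rw [Real.norm_eq_abs, abs_pow]
        have : |G n x - G₀ x| ≤ 2 * M := by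
          have := abs_sub (G n x) (G₀ x)
          linarith [hGb n x, hG₀b x]
        gcongr)
      (ae_of_all _ fun x => by simpa using ((hlim x).sub_const (G₀ x)).pow 2)
    simpa using this
  obtain ⟨N, hN⟩ := eventually_atTop.1 (hdct.eventually_lt_const (show (0 : ℝ) < η / 8 by positivity))
  refine ⟨N, fun n hn m hm => ?_⟩
  have hf := (hh n).sub (hh m)
  have h1 := integral_sq_le_smoothed hf ρ
  have h2 : ∀ x, ∫ z, r z * (h n (x + z) - h m (x + z)) = G n x - G m x := fun x => by
    have hi : ∀ k, Integrable (fun z => r z * h k (x + z)) := fun k => by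
      refine Continuous.integrable_of_hasCompactSupport ?_ hrs.mul_right
      have := (hh k).continuous
      fun_prop
    rw [hG, ← integral_sub (hi n) (hi m)]
    congr 1; ext z; ring
  rw [← hr] at h1
  simp only [h2] at h1
  have hzero : ∀ x, x ∉ Ω → h n x - h m x = 0 := fun x hx => hf.eq_zero hx
  have h3 : ∫ x, (h n x - h m x) * (G n x - G m x)
      = ∫ x in Ω, (h n x - h m x) * (G n x - G m x) :=
    (setIntegral_eq_integral_of_forall_compl_eq_zero fun x hx => by simp [hzero x hx]).symm
  have h4 : ∫ x, (h n x - h m x) ^ 2 = ∫ x in Ω, (h n x - h m x) ^ 2 :=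
    (setIntegral_eq_integral_of_forall_compl_eq_zero fun x hx => by simp [hzero x hx]).symm
  have h5 := (le_abs_self _).trans
    (integral_mul_le_half (hf.memLp.restrict Ω) ((hGL n).sub (hGL m)) one_pos)
  have h6 : ∫ x in Ω, (G n x - G m x) ^ 2
      ≤ 2 * (∫ x in Ω, (G n x - G₀ x) ^ 2) + 2 * ∫ x in Ω, (G m x - G₀ x) ^ 2 := by
    have i1 : IntegrableOn (fun x => 2 * (G n x - G₀ x) ^ 2) Ω :=
      ((hGL n).sub hG₀L).integrable_sq.const_mul 2
    have i2 : IntegrableOn (fun x => 2 * (G m x - G₀ x) ^ 2) Ω :=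
      ((hGL m).sub hG₀L).integrable_sq.const_mul 2
    rw [← integral_const_mul, ← integral_const_mul, ← integral_add i1 i2]
    refine integral_mono ((hGL n).sub (hGL m)).integrable_sq (i1.add i2) fun x => ?_
    simp only
    nlinarith [sq_nonneg ((G n x - G₀ x) + (G m x - G₀ x))]
  have h7 := (integral_gradSqR_sub_le (hh n) (hh m)).trans
    (add_le_add (mul_le_mul_of_nonneg_left (hC n) two_pos.le)
      (mul_le_mul_of_nonneg_left (hC m) two_pos.le))
  have h8 : ρ.rOut ^ 2 = η / (8 * (C + 1)) := ht2
  have h9 : ρ.rOut ^ 2 / 2 * ∫ x, gradSqR (fun x => h n x - h m x) x ≤ η / 4 := by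
    calc _ ≤ ρ.rOut ^ 2 / 2 * (2 * C + 2 * C) := by gcongr
      _ ≤ ρ.rOut ^ 2 / 2 * (4 * (C + 1)) := by gcongr; linarith
      _ = η / 4 := by rw [h8]; field_simp; ring
  have ha := hN n hn
  have hb' := hN m hm
  simp only [Pi.sub_apply] at h5
  rw [h3] at h1
  norm_num at h5
  linarith

/-- Rellich compactness for test functions. -/
theorem exists_rellich {Ω : Set Pt} (hb : Bornology.IsBounded Ω)
    {h : ℕ → Pt → ℝ} (hh : ∀ n, IsTest Ω (h n)) {C : ℝ} (hC : ∀ n, ∫ x, gradSqR (h n) x ≤ C) :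
    ∃ σ : ℕ → ℕ, StrictMono σ ∧ ∃ (h₀ : Pt → ℝ) (H : Fin 2 → Pt → ℝ), MemLp h₀ 2 volume ∧
      (∀ i, MemLp (H i) 2 volume) ∧
      Tendsto (fun n => ∫ x, (h (σ n) x - h₀ x) ^ 2) atTop (𝓝 0) ∧
      ∀ i, WeakLim (fun n x => pdR (h (σ n)) x i) (H i) := by
  obtain ⟨Cp, hCp0, hCp⟩ := exists_poincare hb
  obtain ⟨h₀, hh₀, σ₁, hσ₁, w₁⟩ := exists_weak_limit h (fun n => (hh n).memLp) (Cp * C)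
    fun n => (hCp _ (hh n)).trans (mul_le_mul_of_nonneg_left (hC n) hCp0)
  have hpd : ∀ n i, ∫ x, pdR (h n) x i ^ 2 ≤ C := fun n i => by
    refine le_trans (integral_mono ((hh n).memLp_pdR i).integrable_sq (hh n).integrable_gradSqR
      fun x => ?_) (hC n)
    exact Finset.single_le_sum (f := fun i => pdR (h n) x i ^ 2) (fun _ _ => sq_nonneg _)
      (Finset.mem_univ i)
  obtain ⟨H0, hH0, σ₂, hσ₂, w₂⟩ := exists_weak_limit (fun n x => pdR (h (σ₁ n)) x 0)
    (fun n => (hh _).memLp_pdR 0) C fun n => hpd _ 0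
  obtain ⟨H1, hH1, σ₃, hσ₃, w₃⟩ := exists_weak_limit (fun n x => pdR (h (σ₁ (σ₂ n))) x 1)
    (fun n => (hh _).memLp_pdR 1) C fun n => hpd _ 1
  have hσ : StrictMono fun n => σ₁ (σ₂ (σ₃ n)) := hσ₁.comp (hσ₂.comp hσ₃)
  have w₀ : WeakLim (fun n => h (σ₁ (σ₂ (σ₃ n)))) h₀ := by
    have w : WeakLim (fun n => h (σ₁ n)) h₀ := w₁
    exact w.comp (σ := fun n => σ₂ (σ₃ n)) (hσ₂.comp hσ₃)
  refine ⟨fun n => σ₁ (σ₂ (σ₃ n)), hσ, h₀, ![H0, H1], hh₀, ?_, ?_, ?_⟩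
  · intro i; fin_cases i
    exacts [hH0, hH1]
  · rw [Metric.tendsto_atTop]
    intro η hη
    obtain ⟨N, hN⟩ := cauchy_of_weakLim hb (fun n => hh (σ₁ (σ₂ (σ₃ n)))) (fun n => hC _) w₀
      (half_pos hη)
    refine ⟨N, fun n hn => ?_⟩
    set k : ℕ → Pt → ℝ := fun n => h (σ₁ (σ₂ (σ₃ n))) with hk
    have hkm : ∀ n, MemLp (k n) 2 volume := fun n => (hh _).memLp
    have hg : MemLp (fun x => k n x - h₀ x) 2 volume := (hkm n).sub hh₀
    have t1 : Tendsto (fun m => ∫ x, (k n x - h₀ x) * (k n x - k m x)) atTop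
        (𝓝 (∫ x, (k n x - h₀ x) ^ 2)) := by
      have e : ∀ f : Pt → ℝ, MemLp f 2 volume → ∫ x, (k n x - h₀ x) * (k n x - f x)
          = (∫ x, (k n x - h₀ x) * k n x) - ∫ x, (k n x - h₀ x) * f x := fun f hf => by
        have i1 : Integrable (fun x => (k n x - h₀ x) * k n x) := hg.integrable_mul (hkm n)
        have i2 : Integrable (fun x => (k n x - h₀ x) * f x) := hg.integrable_mul hf
        rw [← integral_sub i1 i2]
        congr 1; ext x; ring
      simp only [e _ (hkm _)]
      have e0 := e h₀ hh₀
      have e1 : ∫ x, (k n x - h₀ x) ^ 2 = ∫ x, (k n x - h₀ x) * (k n x - h₀ x) := by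
        simp only [sq]
      rw [e1, e0]
      exact (w₀ _ hg).const_sub _
    have t2 : ∫ x, (k n x - h₀ x) ^ 2
        ≤ 1 / 2 * (∫ x, (k n x - h₀ x) ^ 2) + 1 / 2 * (η / 2) := by
      refine le_of_tendsto t1 (eventually_atTop.2 ⟨N, fun m hm => ?_⟩)
      have h5 := (le_abs_self _).trans
        (integral_mul_le_half hg ((hkm n).sub (hkm m)) one_pos)
      have h6 := hN n hn m hm
      simp only [Pi.sub_apply] at h5
      norm_num at h5
      linarith
    have t3 : 0 ≤ ∫ x, (k n x - h₀ x) ^ 2 := integral_nonneg fun x => sq_nonneg _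
    rw [Real.dist_eq, sub_zero, abs_of_nonneg t3]
    linarith
  · intro i; fin_cases i
    · have w : WeakLim (fun n x => pdR (h (σ₁ (σ₂ n))) x 0) H0 := w₂
      exact w.comp hσ₃
    · exact w₃

theorem contDiffAt_pdR {Ω : Set Pt} (hΩ : IsOpen Ω) {f : Pt → ℝ} (hf : ContDiffOn ℝ 2 f Ω)
    {x : Pt} (hx : x ∈ Ω) (i : Fin 2) : ContDiffAt ℝ 1 (fun y => pdR f y i) x :=
  ((hf.contDiffAt (hΩ.mem_nhds hx)).fderiv_right (m := 1) (by norm_num)).clm_apply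
    contDiffAt_const

theorem fderiv_apply_eq_sum (L : Pt →L[ℝ] ℝ) (z : Pt) :
    L z = z 0 * L (EuclideanSpace.single 0 1) + z 1 * L (EuclideanSpace.single 1 1) := by
  have hz : z = z 0 • (EuclideanSpace.single 0 (1 : ℝ) : Pt)
      + z 1 • (EuclideanSpace.single 1 (1 : ℝ) : Pt) := by
    ext j
    fin_cases j <;> simp
  conv_lhs => rw [hz]
  simp

/-- A harmonic function with bounded gradient on a bounded star-shaped domain has a bounded
harmonic conjugate. -/
theorem exists_harmonic_conjugate {Ω : Set Pt} (hΩ : IsOpen Ω) (hne : Ω.Nonempty)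
    (hb : Bornology.IsBounded Ω) (hstar : ∃ x₀, StarConvex ℝ x₀ Ω) {φ : Pt → ℝ}
    (hφ : ContDiffOn ℝ 2 φ Ω) (hharm : ∀ x ∈ Ω, lapR φ x = 0) {M : ℝ}
    (hM : ∀ x ∈ Ω, ∀ i, |pdR φ x i| ≤ M) :
    ∃ (f : Pt → ℝ) (K : ℝ), ∀ x ∈ Ω, DifferentiableAt ℝ f x ∧ pdR f x 0 = pdR φ x 1 ∧
      pdR f x 1 = -pdR φ x 0 ∧ |f x| ≤ K := by
  obtain ⟨x₀, hx₀⟩ := hstar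
  have hx₀Ω : x₀ ∈ Ω := hx₀.mem hne
  let p : Fin 2 → Pt →L[ℝ] ℝ := fun i => EuclideanSpace.proj i
  have hp : ∀ i (x : Pt), p i x = x i := fun i x => rfl
  set ω : Pt → Pt →L[ℝ] ℝ := fun x => pdR φ x 1 • p 0 - pdR φ x 0 • p 1 with hω
  set dω : Pt → Pt →L[ℝ] Pt →L[ℝ] ℝ := fun x =>
    (fderiv ℝ (fun y => pdR φ y 1) x).smulRight (p 0)
      - (fderiv ℝ (fun y => pdR φ y 0) x).smulRight (p 1) with hdω
  have hd : ∀ x ∈ Ω, HasFDerivAt ω (dω x) x := fun x hx => by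
    have h : ∀ i, HasFDerivAt (fun y => pdR φ y i) (fderiv ℝ (fun y => pdR φ y i) x) x := fun i =>
      ((contDiffAt_pdR hΩ hφ hx i).differentiableAt (by norm_num)).hasFDerivAt
    exact ((h 1).smul_const (p 0)).sub ((h 0).smul_const (p 1))
  have hsymm : ∀ x ∈ Ω, ∀ a b, dω x a b = dω x b a := fun x hx a b => by
    have h1 := hharm x hx
    simp only [lapR, Fin.sum_univ_two] at h1
    simp only [hdω, sub_apply, ContinuousLinearMap.smulRight_apply,
      smul_apply, smul_eq_mul, hp]
    rw [fderiv_apply_eq_sum (fderiv ℝ (fun y => pdR φ y 1) x) a,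
      fderiv_apply_eq_sum (fderiv ℝ (fun y => pdR φ y 1) x) b,
      fderiv_apply_eq_sum (fderiv ℝ (fun y => pdR φ y 0) x) a,
      fderiv_apply_eq_sum (fderiv ℝ (fun y => pdR φ y 0) x) b]
    linear_combination (a 1 * b 0 - a 0 * b 1) * h1
  have hnorm : ∀ x ∈ Ω, ‖ω x‖ ≤ M * ‖p 0‖ + M * ‖p 1‖ := fun x hx => by
    refine (norm_sub_le _ _).trans ?_
    rw [norm_smul, norm_smul]
    gcongr
    exacts [hM x hx 1, hM x hx 0]
  set f : Pt → ℝ := fun c => ∫ᶜ x in .segment x₀ c, ω x with hf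
  obtain ⟨R, hR⟩ := hb.subset_ball x₀
  have hfd : ∀ x ∈ Ω, HasFDerivAt f (ω x) x := fun x hx => by
    obtain ⟨r, hr, hball⟩ := Metric.isOpen_iff.1 hΩ x hx
    set s := convexHull ℝ (insert x₀ (Metric.ball x r)) with hs
    have hsΩ : s ⊆ Ω := by
      rw [hs, convexHull_insert (Metric.nonempty_ball.2 hr), (convex_ball x r).convexHull_eq]
      intro y hy
      rw [mem_convexJoin] at hy
      obtain ⟨a, ha, b, hb', hy⟩ := hy
      rw [Set.mem_singleton_iff] at ha
      subst ha
      exact hx₀.segment_subset (hball hb') hy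
    have hsn : s ∈ 𝓝 x := mem_of_superset (Metric.ball_mem_nhds x hr)
      ((Set.subset_insert _ _).trans (subset_convexHull ℝ _))
    exact ((convex_convexHull ℝ _).hasFDerivWithinAt_curveIntegral_segment_of_hasFDerivWithinAt_symmetric
      (fun y hy => (hd y (hsΩ hy)).hasFDerivWithinAt)
      (fun y hy a _ b _ => hsymm y (hsΩ hy) a b)
      (subset_convexHull ℝ _ (Set.mem_insert _ _)) (mem_of_mem_nhds hsn)).hasFDerivAt hsn
  refine ⟨f, (M * ‖p 0‖ + M * ‖p 1‖) * R, fun x hx => ⟨(hfd x hx).differentiableAt, ?_, ?_, ?_⟩⟩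
  · rw [pdR, (hfd x hx).fderiv]
    simp [hω, hp]
  · rw [pdR, (hfd x hx).fderiv]
    simp [hω, hp]
  · refine (norm_curveIntegral_segment_le fun z hz => hnorm z (hx₀.segment_subset hx hz)).trans ?_
    have h0 := (norm_nonneg (ω x)).trans (hnorm x hx)
    gcongr
    exact (mem_ball_iff_norm.1 (hR hx)).le

theorem integral_mul_pdR_eq_neg {Ω : Set Pt} (hΩ : IsOpen Ω) {f g : Pt → ℝ}
    (hf : ∀ x ∈ Ω, DifferentiableAt ℝ f x) {i : Fin 2} (hq : ContinuousOn (fun x => pdR f x i) Ω)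
    (hg : ContDiff ℝ 1 g) (hgc : HasCompactSupport g) (hgs : tsupport g ⊆ Ω) :
    Integrable (fun x => g x * pdR f x i) ∧ Integrable (fun x => f x * pdR g x i) ∧
    ∫ x, g x * pdR f x i = -∫ x, f x * pdR g x i := by
  have hsg : HasCompactSupport (fun x => pdR g x i) := hgc.fderiv_apply ℝ _
  have hcg : Continuous (fun x => pdR g x i) :=
    (hg.continuous_fderiv (by norm_num)).clm_apply continuous_const
  have hsg' : tsupport (fun x => pdR g x i) ⊆ Ω := (tsupport_fderiv_apply_subset ℝ _).trans hgs
  have i1 : Integrable (fun x => g x * pdR f x i) := by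
    refine Continuous.integrable_of_hasCompactSupport (continuous_of_tsupport fun x hx => ?_)
      hgc.mul_right
    exact hg.continuous.continuousAt.mul
      (hq.continuousAt (hΩ.mem_nhds (hgs (tsupport_mul_subset_left hx))))
  have i2 : Integrable (fun x => f x * pdR g x i) := by
    refine Continuous.integrable_of_hasCompactSupport (continuous_of_tsupport fun x hx => ?_)
      hsg.mul_left
    exact (hf x (hsg' (tsupport_mul_subset_right hx))).continuousAt.mul hcg.continuousAt
  have i3 : Integrable (fun x => g x * f x) := by
    refine Continuous.integrable_of_hasCompactSupport (continuous_of_tsupport fun x hx => ?_)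
      hgc.mul_right
    exact hg.continuous.continuousAt.mul (hf x (hgs (tsupport_mul_subset_left hx))).continuousAt
  refine ⟨i1, i2, ?_⟩
  have := integral_mul_fderiv_eq_neg_fderiv_mul_of_integrable (μ := volume) (f := g) (g := f)
    (v := EuclideanSpace.single i (1 : ℝ)) (i2.congr (ae_of_all _ fun x => mul_comm _ _)) i1 i3
    (fun x _ => hg.differentiable (by norm_num) x) (fun x hx => hf x (hgs hx))
  refine this.trans ?_
  congr 2
  ext x
  exact mul_comm _ _

theorem pdR_mul {f g : Pt → ℝ} {x : Pt} (hf : DifferentiableAt ℝ f x) (hg : DifferentiableAt ℝ g x)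
    (i : Fin 2) : pdR (fun y => f y * g y) x i = f x * pdR g x i + pdR f x i * g x := by
  simp only [pdR]
  rw [fderiv_fun_mul hf hg]
  simp [mul_comm (g x)]

theorem pdR_add {f g : Pt → ℝ} {x : Pt} (hf : DifferentiableAt ℝ f x) (hg : DifferentiableAt ℝ g x)
    (i : Fin 2) : pdR (fun y => f y + g y) x i = pdR f x i + pdR g x i := by
  simp only [pdR]
  rw [fderiv_fun_add hf hg]
  simp

theorem IsTest.pdR_pdR_comm {Ω : Set Pt} {h : Pt → ℝ} (hh : IsTest Ω h) (x : Pt) (i j : Fin 2) :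
    pdR (fun y => pdR h y i) x j = pdR (fun y => pdR h y j) x i := by
  have hd : DifferentiableAt ℝ (fderiv ℝ h) x :=
    (hh.contDiff.fderiv_right (m := 1) (by norm_num)).differentiable (by norm_num) x
  have key : ∀ v w : Pt, fderiv ℝ (fun y => fderiv ℝ h y v) x w = fderiv ℝ (fderiv ℝ h) x w v := by
    intro v w
    rw [fderiv_clm_apply hd (differentiableAt_const _)]
    simp
  simp only [pdR]
  rw [key, key]
  exact (hh.contDiff.contDiffAt.isSymmSndFDerivAt (by simp)) _ _

/-- The Jacobian structure of the coupling term. -/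
theorem integral_mul_wedge_eq {Ω : Set Pt} (hΩ : IsOpen Ω) {f : Pt → ℝ}
    (hf : ∀ x ∈ Ω, DifferentiableAt ℝ f x) (hq : ∀ i, ContinuousOn (fun x => pdR f x i) Ω)
    {a b : Pt → ℝ} (ha : IsTest Ω a) (hb : IsTest Ω b) :
    (∫ x, b x * pdR a x 1 * pdR f x 0) - ∫ x, b x * pdR a x 0 * pdR f x 1
      = (∫ x, f x * pdR b x 1 * pdR a x 0) - ∫ x, f x * pdR b x 0 * pdR a x 1 := by
  have hs : ∀ i, ContDiff ℝ 1 (fun x => b x * pdR a x i) := fun i =>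
    (hb.contDiff.of_le (by norm_num)).mul (ha.contDiff_pdR i)
  have h1 := fun i j => integral_mul_pdR_eq_neg hΩ hf (hq j) (hs i) hb.compact.mul_right
    ((tsupport_mul_subset_left).trans hb.subset)
  rw [(h1 1 0).2.2, (h1 0 1).2.2, neg_sub_neg, ← integral_sub (h1 0 1).2.1 (h1 1 0).2.1]
  have hI : ∀ i j, Integrable (fun x => f x * pdR b x i * pdR a x j) := fun i j => by
    refine Continuous.integrable_of_hasCompactSupport (continuous_of_tsupport fun x hx => ?_)
      (ha.compact_pdR j).mul_left
    have hx' : x ∈ Ω := ha.subset ((tsupport_fderiv_apply_subset ℝ _) (tsupport_mul_subset_right hx))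
    exact ((hf x hx').continuousAt.mul (hb.continuous_pdR i).continuousAt).mul
      (ha.continuous_pdR j).continuousAt
  rw [← integral_sub (hI 1 0) (hI 0 1)]
  congr 1; ext x
  have hd : ∀ i, DifferentiableAt ℝ (fun y => pdR a y i) x := fun i =>
    (ha.contDiff_pdR i).differentiable (by norm_num) x
  rw [pdR_mul (hb.differentiable x) (hd 0), pdR_mul (hb.differentiable x) (hd 1),
    ha.pdR_pdR_comm x 0 1]
  ring

theorem weakLim_of_tendsto {f : ℕ → Pt → ℝ} {f₀ : Pt → ℝ} (hf : ∀ n, MemLp (f n) 2 volume)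
    (hf₀ : MemLp f₀ 2 volume) (h : Tendsto (fun n => ∫ x, (f n x - f₀ x) ^ 2) atTop (𝓝 0)) :
    WeakLim f f₀ := by
  intro g hg
  have h1 := tendsto_integral_mul_mul_zero (l := atTop) (k := fun _ : Pt => (1 : ℝ)) (M := 1)
    aestronglyMeasurable_const (fun _ => by simp) (fun n => (hf n).sub hf₀)
    (fun _ : ℕ => hg) h (Eventually.of_forall fun _ => le_rfl)
  have h2 := h1.add_const (∫ x, g x * f₀ x)
  rw [zero_add] at h2
  refine h2.congr fun n => ?_
  have e1 : Integrable (fun x => 1 * (f n x - f₀ x) * g x) :=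
    ((((hf n).sub hf₀).integrable_mul hg)).congr (ae_of_all _ fun x => by simp)
  have e2 : Integrable (fun x => g x * f₀ x) := hg.integrable_mul hf₀
  simp only [Pi.sub_apply]
  rw [← integral_add e1 e2]
  congr 1; ext x; ring

theorem memLp_bdd_mul {k f : Pt → ℝ} {M : ℝ} (hk : AEStronglyMeasurable k volume)
    (hM : ∀ x, |k x| ≤ M) (hf : MemLp f 2 volume) : MemLp (fun x => k x * f x) 2 volume :=
  hf.of_le_mul (c := M) (hk.mul hf.1) (ae_of_all _ fun x => by
    rw [norm_mul]; exact mul_le_mul_of_nonneg_right (hM x) (norm_nonneg _))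

theorem IsTest.integral_pdR_sq_le {Ω : Set Pt} {h : Pt → ℝ} (hh : IsTest Ω h) (i : Fin 2) :
    ∫ x, pdR h x i ^ 2 ≤ ∫ x, gradSqR h x :=
  integral_mono (hh.memLp_pdR i).integrable_sq hh.integrable_gradSqR fun x =>
    Finset.single_le_sum (f := fun i => pdR h x i ^ 2) (fun _ _ => sq_nonneg _) (Finset.mem_univ i)

theorem tendsto_integral_mul_of_L1 {k : Pt → ℝ} {s : ℕ → Pt → ℝ} {M : ℝ}
    (hM : ∀ x, |k x| ≤ M) (hs : ∀ n, Integrable (s n))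
    (h : Tendsto (fun n => ∫ x, |s n x|) atTop (𝓝 0)) :
    Tendsto (fun n => ∫ x, k x * s n x) atTop (𝓝 0) := by
  refine squeeze_zero_norm (a := fun n => M * ∫ x, |s n x|) (fun n => ?_)
    (by simpa using h.const_mul M)
  rw [← integral_const_mul]
  refine (norm_integral_le_integral_norm _).trans (integral_mono_of_nonneg
    (ae_of_all _ fun x => norm_nonneg _) ((hs n).abs.const_mul M) (ae_of_all _ fun x => ?_))
  simp only [norm_mul, Real.norm_eq_abs]
  exact mul_le_mul_of_nonneg_right (hM x) (abs_nonneg _)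

/-- The constraint `(1 + α)² + b² = 1` and its derivative pass to the limit. -/
theorem ae_wedge_eq_zero {Ω : Set Pt} (hΩ : IsOpen Ω) {α b : ℕ → Pt → ℝ} {α₀ b₀ : Pt → ℝ}
    {A B : Fin 2 → Pt → ℝ} {C : ℝ} (hα : ∀ n, IsTest Ω (α n)) (hb : ∀ n, IsTest Ω (b n))
    (hα₀ : MemLp α₀ 2 volume) (hb₀ : MemLp b₀ 2 volume)
    (hA : ∀ i, MemLp (A i) 2 volume) (hB : ∀ i, MemLp (B i) 2 volume)
    (hαC : ∀ n, ∫ x, gradSqR (α n) x ≤ C) (hbC : ∀ n, ∫ x, gradSqR (b n) x ≤ C)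
    (hαα : Tendsto (fun n => ∫ x, (α n x - α₀ x) ^ 2) atTop (𝓝 0))
    (hbb : Tendsto (fun n => ∫ x, (b n x - b₀ x) ^ 2) atTop (𝓝 0))
    (hαC' : ∀ n, ∫ x, α n x ^ 2 ≤ C) (hbC' : ∀ n, ∫ x, b n x ^ 2 ≤ C)
    (hAw : ∀ i, WeakLim (fun n x => pdR (α n) x i) (A i))
    (hBw : ∀ i, WeakLim (fun n x => pdR (b n) x i) (B i))
    (hc : Tendsto (fun n => ∫ x, |2 * α n x + α n x ^ 2 + b n x ^ 2|) atTop (𝓝 0)) :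
    ∀ᵐ x, x ∈ Ω → B 1 x * A 0 x - B 0 x * A 1 x = 0 := by
  have hαm := fun n => (hα n).memLp
  have hbm := fun n => (hb n).memLp
  have hαw : WeakLim α α₀ := weakLim_of_tendsto hαm hα₀ hαα
  have hbw : WeakLim b b₀ := weakLim_of_tendsto hbm hb₀ hbb
  have hsi : ∀ n, Integrable (fun x => 2 * α n x + α n x ^ 2 + b n x ^ 2) := fun n =>
    ((((hα n).continuous.integrable_of_hasCompactSupport (hα n).compact).const_mul 2).add
      (hαm n).integrable_sq).add (hbm n).integrable_sq
  have loc : ∀ {f : Pt → ℝ}, MemLp f 2 volume → LocallyIntegrable f := fun hf =>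
    hf.locallyIntegrable (by norm_num)
  have hprod : ∀ {f g : Pt → ℝ}, MemLp f 2 volume → MemLp g 2 volume →
      Integrable (fun x => f x * g x) := fun hf hg => hf.integrable_mul hg
  have bound : ∀ {g : Pt → ℝ}, Continuous g → HasCompactSupport g → ∃ M, ∀ x, |g x| ≤ M :=
    fun hg hgc => hg.bounded_above_of_compact_support hgc
  have c1 : ∀ᵐ x, x ∈ Ω → 2 * α₀ x + α₀ x * α₀ x + b₀ x * b₀ x = 0 := by
    refine hΩ.ae_eq_zero_of_integral_contDiff_smul_eq_zero
      ((((loc (hα₀.const_mul 2)).add (hprod hα₀ hα₀).locallyIntegrable).add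
        (hprod hb₀ hb₀).locallyIntegrable).locallyIntegrableOn _) fun g hg hgc _ => ?_
    obtain ⟨M, hM⟩ := bound hg.continuous hgc
    have hgm : MemLp g 2 volume := hg.continuous.memLp_of_hasCompactSupport hgc
    have hgs := hg.continuous.aestronglyMeasurable (μ := volume)
    have t1 := (hαw _ (hgm.const_mul 2))
    have t2 := WeakLim.tendsto_mul hgs hM hαm hα₀ hαm hαα hαC' hαw
    have t3 := WeakLim.tendsto_mul hgs hM hbm hb₀ hbm hbb hbC' hbw
    have e : ∀ (p q : Pt → ℝ), MemLp p 2 volume → MemLp q 2 volume →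
        (∫ x, 2 * g x * p x) + (∫ x, g x * p x * p x) + (∫ x, g x * q x * q x)
        = ∫ x, g x * (2 * p x + p x ^ 2 + q x ^ 2) := fun p q hp hq => by
      have i1 : Integrable (fun x => 2 * g x * p x) := hprod (hgm.const_mul 2) hp
      have i2 : Integrable (fun x => g x * p x * p x) := hprod (memLp_bdd_mul hgs hM hp) hp
      have i3 : Integrable (fun x => g x * q x * q x) := hprod (memLp_bdd_mul hgs hM hq) hq
      have i4 : Integrable (fun x => 2 * g x * p x + g x * p x * p x) := i1.add i2
      rw [← integral_add i1 i2, ← integral_add i4 i3]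
      congr 1; ext x; ring
    have t4 := (t1.add t2).add t3
    simp only [e _ _ (hαm _) (hbm _), e _ _ hα₀ hb₀] at t4
    have t5 := tendsto_nhds_unique t4 (tendsto_integral_mul_of_L1 hM hsi hc)
    rw [← t5]
    congr 1; ext x; simp only [smul_eq_mul]; ring
  have c2 : ∀ i, ∀ᵐ x, x ∈ Ω → A i x + α₀ x * A i x + b₀ x * B i x = 0 := fun i => by
    refine hΩ.ae_eq_zero_of_integral_contDiff_smul_eq_zero
      ((((loc (hA i)).add (hprod hα₀ (hA i)).locallyIntegrable).add
        (hprod hb₀ (hB i)).locallyIntegrable).locallyIntegrableOn _) fun g hg hgc hgs => ?_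
    obtain ⟨M, hM⟩ := bound hg.continuous hgc
    have hg1 : ContDiff ℝ 1 g := hg.of_le (by exact_mod_cast le_top)
    obtain ⟨M', hM'⟩ := bound (g := fun x => pdR g x i)
      ((hg1.continuous_fderiv (by norm_num)).clm_apply continuous_const) (hgc.fderiv_apply ℝ _)
    have hgm : MemLp g 2 volume := hg.continuous.memLp_of_hasCompactSupport hgc
    have hgsm := hg.continuous.aestronglyMeasurable (μ := volume)
    have t1 := hAw i _ hgm
    have t2 := WeakLim.tendsto_mul hgsm hM hαm hα₀ (fun n => (hα n).memLp_pdR i) hαα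
      (fun n => ((hα n).integral_pdR_sq_le i).trans (hαC n)) (hAw i)
    have t3 := WeakLim.tendsto_mul hgsm hM hbm hb₀ (fun n => (hb n).memLp_pdR i) hbb
      (fun n => ((hb n).integral_pdR_sq_le i).trans (hbC n)) (hBw i)
    have e : ∀ (p q P Q : Pt → ℝ), MemLp p 2 volume → MemLp q 2 volume → MemLp P 2 volume →
        MemLp Q 2 volume →
        (∫ x, g x * P x) + (∫ x, g x * p x * P x) + (∫ x, g x * q x * Q x)
        = ∫ x, g x * (P x + p x * P x + q x * Q x) := fun p q P Q hp hq hP hQ => by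
      have i1 : Integrable (fun x => g x * P x) := hprod hgm hP
      have i2 : Integrable (fun x => g x * p x * P x) := hprod (memLp_bdd_mul hgsm hM hp) hP
      have i3 : Integrable (fun x => g x * q x * Q x) := hprod (memLp_bdd_mul hgsm hM hq) hQ
      have i4 : Integrable (fun x => g x * P x + g x * p x * P x) := i1.add i2
      rw [← integral_add i1 i2, ← integral_add i4 i3]
      congr 1; ext x; ring
    have t4 := (t1.add t2).add t3
    simp only [e _ _ _ _ (hαm _) (hbm _) ((hα _).memLp_pdR i) ((hb _).memLp_pdR i),
      e _ _ _ _ hα₀ hb₀ (hA i) (hB i)] at t4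
    have t5 := (tendsto_integral_mul_of_L1 hM' hsi hc).const_mul (-(1 / 2) : ℝ)
    rw [mul_zero] at t5
    refine tendsto_nhds_unique t4 (t5.congr fun n => ?_)
    have ha := (hα n).differentiable
    have hb' := (hb n).differentiable
    have hs2 : ContDiff ℝ 2 (fun x => 2 * α n x + α n x * α n x + b n x * b n x) :=
      ((contDiff_const.mul (hα n).contDiff).add ((hα n).contDiff.mul (hα n).contDiff)).add
        ((hb n).contDiff.mul (hb n).contDiff)
    have key := (integral_mul_pdR_eq_neg hΩ (i := i)
      (fun x _ => hs2.differentiable (by norm_num) x)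
      ((hs2.continuous_fderiv (by norm_num)).clm_apply continuous_const).continuousOn
      hg1 hgc hgs).2.2
    have hpd : ∀ x, pdR (fun x => 2 * α n x + α n x * α n x + b n x * b n x) x i
        = 2 * (pdR (α n) x i + α n x * pdR (α n) x i + b n x * pdR (b n) x i) := fun x => by
      have d1 : DifferentiableAt ℝ (fun y => 2 * α n y) x := (ha x).const_mul 2
      have d2 : DifferentiableAt ℝ (fun y => α n y * α n y) x := (ha x).mul (ha x)
      have d3 : DifferentiableAt ℝ (fun y => b n y * b n y) x := (hb' x).mul (hb' x)
      have d4 : DifferentiableAt ℝ (fun y => 2 * α n y + α n y * α n y) x := d1.add d2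
      rw [pdR_add d4 d3, pdR_add d1 d2, pdR_mul (ha x) (ha x), pdR_mul (hb' x) (hb' x)]
      have : pdR (fun y => 2 * α n y) x i = 2 * pdR (α n) x i := by
        simp only [pdR]
        rw [fderiv_const_mul (ha x)]
        simp
      rw [this]
      ring
    simp only [hpd] at key
    have e1 : ∫ x, g x * (2 * (pdR (α n) x i + α n x * pdR (α n) x i + b n x * pdR (b n) x i))
        = 2 * ∫ x, g x * (pdR (α n) x i + α n x * pdR (α n) x i + b n x * pdR (b n) x i) := by
      rw [← integral_const_mul]
      congr 1; ext x; ring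
    have e2 : ∫ x, (2 * α n x + α n x * α n x + b n x * b n x) * pdR g x i
        = ∫ x, pdR g x i * (2 * α n x + α n x ^ 2 + b n x ^ 2) := by
      congr 1; ext x; ring
    rw [e1, e2] at key
    linarith
  filter_upwards [c1, c2 0, c2 1] with x h1 h2 h3 hx
  have h1 := h1 hx
  have h2 := h2 hx
  have h3 := h3 hx
  linear_combination (-(B 1 x * A 0 x - B 0 x * A 1 x)) * h1
    + ((1 + α₀ x) * B 1 x - b₀ x * A 1 x) * h2 + (b₀ x * A 0 x - (1 + α₀ x) * B 0 x) * h3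

/-- Compensated compactness: the coupling term vanishes along a subsequence. -/
theorem exists_subseq_tendsto_coupling {Ω : Set Pt} (hΩ : IsOpen Ω) (hbd : Bornology.IsBounded Ω)
    {f : Pt → ℝ} {K M : ℝ} (hf : ∀ x ∈ Ω, DifferentiableAt ℝ f x)
    (hq : ∀ i, ContinuousOn (fun x => pdR f x i) Ω) (hK : ∀ x ∈ Ω, |f x| ≤ K)
    (hM : ∀ x ∈ Ω, ∀ i, |pdR f x i| ≤ M) {α b : ℕ → Pt → ℝ} {C : ℝ}
    (hα : ∀ n, IsTest Ω (α n)) (hb : ∀ n, IsTest Ω (b n))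
    (hαC : ∀ n, ∫ x, gradSqR (α n) x ≤ C) (hbC : ∀ n, ∫ x, gradSqR (b n) x ≤ C)
    (hc : Tendsto (fun n => ∫ x, |2 * α n x + α n x ^ 2 + b n x ^ 2|) atTop (𝓝 0)) :
    ∃ σ : ℕ → ℕ, StrictMono σ ∧ Tendsto (fun n => ∫ x in Ω, b (σ n) x *
      (pdR f x 0 * pdR (α (σ n)) x 1 - pdR f x 1 * pdR (α (σ n)) x 0)) atTop (𝓝 0) := by
  obtain ⟨σ₁, hσ₁, α₀, A, hα₀, hA, hαα, hAw⟩ := exists_rellich hbd hα hαC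
  obtain ⟨σ₂, hσ₂, b₀, B, hb₀, hB, hbb, hBw⟩ := exists_rellich hbd (fun n => hb (σ₁ n))
    (fun n => hbC (σ₁ n))
  obtain ⟨Cp, hCp0, hCp⟩ := exists_poincare hbd
  set σ : ℕ → ℕ := fun n => σ₁ (σ₂ n) with hσdef
  have hσ : StrictMono σ := hσ₁.comp hσ₂
  refine ⟨σ, hσ, ?_⟩
  set a : ℕ → Pt → ℝ := fun n => α (σ n) with ha_def
  set β : ℕ → Pt → ℝ := fun n => b (σ n) with hβ_def
  have ha : ∀ n, IsTest Ω (a n) := fun n => hα _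
  have hβ : ∀ n, IsTest Ω (β n) := fun n => hb _
  set C' := max C (Cp * C) with hC'
  have haC : ∀ n, ∫ x, gradSqR (a n) x ≤ C' := fun n => (hαC _).trans (le_max_left _ _)
  have hβC : ∀ n, ∫ x, gradSqR (β n) x ≤ C' := fun n => (hbC _).trans (le_max_left _ _)
  have haC2 : ∀ n, ∫ x, a n x ^ 2 ≤ C' := fun n => ((hCp _ (ha n)).trans
    (mul_le_mul_of_nonneg_left (hαC _) hCp0)).trans (le_max_right _ _)
  have hβC2 : ∀ n, ∫ x, β n x ^ 2 ≤ C' := fun n => ((hCp _ (hβ n)).trans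
    (mul_le_mul_of_nonneg_left (hbC _) hCp0)).trans (le_max_right _ _)
  have haa : Tendsto (fun n => ∫ x, (a n x - α₀ x) ^ 2) atTop (𝓝 0) :=
    hαα.comp hσ₂.tendsto_atTop
  have hAw' : ∀ i, WeakLim (fun n x => pdR (a n) x i) (A i) := fun i => (hAw i).comp hσ₂
  have hc' := hc.comp hσ.tendsto_atTop
  have hae := ae_wedge_eq_zero hΩ ha hβ hα₀ hb₀ hA hB haC hβC haa hbb haC2 hβC2 hAw' hBw hc'
  have ham := fun n => (ha n).memLp
  have hβm := fun n => (hβ n).memLp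
  set q : Fin 2 → Pt → ℝ := fun i => Ω.indicator fun x => pdR f x i with hqdef
  set F : Pt → ℝ := Ω.indicator f with hFdef
  have hqm : ∀ i, AEStronglyMeasurable (q i) volume := fun i =>
    (aestronglyMeasurable_indicator_iff hΩ.measurableSet).2
      ((hq i).aestronglyMeasurable hΩ.measurableSet)
  have hFm : AEStronglyMeasurable F volume :=
    (aestronglyMeasurable_indicator_iff hΩ.measurableSet).2 (ContinuousOn.aestronglyMeasurable
      (fun x hx => (hf x hx).continuousAt.continuousWithinAt) hΩ.measurableSet)
  have hqM : ∀ i x, |q i x| ≤ |M| := fun i x => by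
    by_cases hx : x ∈ Ω
    · simpa [hqdef, hx] using (hM x hx i).trans (le_abs_self M)
    · simp [hqdef, hx]
  have hFK : ∀ x, |F x| ≤ |K| := fun x => by
    by_cases hx : x ∈ Ω
    · simpa [hFdef, hx] using (hK x hx).trans (le_abs_self K)
    · simp [hFdef, hx]
  have hprod : ∀ {f g : Pt → ℝ}, MemLp f 2 volume → MemLp g 2 volume →
      Integrable (fun x => f x * g x) := fun hf hg => hf.integrable_mul hg
  have t1 : ∀ i j, Tendsto (fun n => ∫ x, q i x * β n x * pdR (a n) x j) atTop
      (𝓝 (∫ x, q i x * b₀ x * A j x)) := fun i j =>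
    WeakLim.tendsto_mul (hqm i) (hqM i) hβm hb₀ (fun n => (ha n).memLp_pdR j) hbb
      (fun n => ((ha n).integral_pdR_sq_le j).trans (haC n)) (hAw' j)
  have hβw := weakLim_of_tendsto hβm hb₀ hbb
  have wk : ∀ (m : ℕ), (∫ x, q 0 x * β m x * A 1 x) - ∫ x, q 1 x * β m x * A 0 x
      = (∫ x, F x * pdR (β m) x 1 * A 0 x) - ∫ x, F x * pdR (β m) x 0 * A 1 x := fun m => by
    have s1 : ∀ i j, Tendsto (fun n => ∫ x, q i x * β m x * pdR (a n) x j) atTop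
        (𝓝 (∫ x, q i x * β m x * A j x)) := fun i j =>
      hAw' j _ (memLp_bdd_mul (hqm i) (hqM i) (hβm m))
    have s2 : ∀ i j, Tendsto (fun n => ∫ x, F x * pdR (β m) x i * pdR (a n) x j) atTop
        (𝓝 (∫ x, F x * pdR (β m) x i * A j x)) := fun i j =>
      hAw' j _ (memLp_bdd_mul hFm hFK ((hβ m).memLp_pdR i))
    refine tendsto_nhds_unique ((s1 0 1).sub (s1 1 0)) (((s2 1 0).sub (s2 0 1)).congr fun n => ?_)
    have key := integral_mul_wedge_eq hΩ hf hq (ha n) (hβ m)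
    have e1 : ∀ i j, ∫ x, q i x * β m x * pdR (a n) x j
        = ∫ x, β m x * pdR (a n) x j * pdR f x i := fun i j => by
      congr 1; ext x
      by_cases hx : x ∈ Ω
      · simp only [hqdef, Set.indicator_of_mem hx]; ring
      · simp [(hβ m).eq_zero hx]
    have e2 : ∀ i j, ∫ x, F x * pdR (β m) x i * pdR (a n) x j
        = ∫ x, f x * pdR (β m) x i * pdR (a n) x j := fun i j => by
      congr 1; ext x
      by_cases hx : x ∈ Ω
      · simp only [hFdef, Set.indicator_of_mem hx]
      · have : pdR (β m) x i = 0 := image_eq_zero_of_notMem_tsupport (f := fun x => pdR (β m) x i)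
          fun h => hx ((hβ m).subset (tsupport_fderiv_apply_subset ℝ _ h))
        simp [this]
    rw [e1, e1, e2, e2, key]
  have wk2 : (∫ x, q 0 x * b₀ x * A 1 x) - ∫ x, q 1 x * b₀ x * A 0 x
      = (∫ x, F x * B 1 x * A 0 x) - ∫ x, F x * B 0 x * A 1 x := by
    have s1 : ∀ i j, Tendsto (fun m => ∫ x, q i x * β m x * A j x) atTop
        (𝓝 (∫ x, q i x * b₀ x * A j x)) := fun i j => by
      have h := hβw _ (memLp_bdd_mul (hqm i) (hqM i) (hA j))
      simpa only [mul_right_comm] using h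
    have s2 : ∀ i j, Tendsto (fun m => ∫ x, F x * pdR (β m) x i * A j x) atTop
        (𝓝 (∫ x, F x * B i x * A j x)) := fun i j => by
      have h := hBw i _ (memLp_bdd_mul hFm hFK (hA j))
      simpa only [mul_right_comm] using h
    exact tendsto_nhds_unique ((s1 0 1).sub (s1 1 0))
      (((s2 1 0).sub (s2 0 1)).congr fun m => (wk m).symm)
  have wk3 : (∫ x, F x * B 1 x * A 0 x) - ∫ x, F x * B 0 x * A 1 x = 0 := by
    have i : ∀ i j, Integrable (fun x => F x * B i x * A j x) := fun i j =>
      hprod (memLp_bdd_mul hFm hFK (hB i)) (hA j)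
    rw [← integral_sub (i 1 0) (i 0 1)]
    refine integral_eq_zero_of_ae (hae.mono fun x hx => ?_)
    by_cases hx' : x ∈ Ω
    · simp only [Pi.zero_apply]
      linear_combination F x * hx hx'
    · simp [hFdef, hx']
  have t2 := (t1 0 1).sub (t1 1 0)
  rw [wk2, wk3] at t2
  refine t2.congr fun n => ?_
  have i : ∀ i j, Integrable (fun x => q i x * β n x * pdR (a n) x j) := fun i j =>
    hprod (memLp_bdd_mul (hqm i) (hqM i) (hβm n)) ((ha n).memLp_pdR j)
  rw [← integral_sub (i 0 1) (i 1 0), ← integral_indicator hΩ.measurableSet]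
  congr 1; ext x
  by_cases hx : x ∈ Ω
  · simp only [hqdef, Set.indicator_of_mem hx]
    ring
  · simp [hqdef, hx]

theorem exists_bound_fderiv {Ω : Set Pt} (hΩ : IsOpen Ω) (hbd : Bornology.IsBounded Ω) {f : Pt → ℝ}
    (hf : ContDiffOn ℝ 1 f (closure Ω)) : ∃ M, ∀ x ∈ Ω, ‖fderiv ℝ f x‖ ≤ M := by
  have key : ∃ M, ∀ x ∈ closure Ω, x ∈ Ω → ‖fderiv ℝ f x‖ ≤ M := by
    refine hbd.isCompact_closure.induction_on
      (p := fun s => ∃ M, ∀ x ∈ s, x ∈ Ω → ‖fderiv ℝ f x‖ ≤ M) ⟨0, by simp⟩ ?_ ?_ ?_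
    · rintro s t hst ⟨M, hM⟩
      exact ⟨M, fun x hx => hM x (hst hx)⟩
    · rintro s t ⟨M, hM⟩ ⟨M', hM'⟩
      refine ⟨max M M', fun x hx hxΩ => ?_⟩
      rcases hx with hx | hx
      · exact (hM x hx hxΩ).trans (le_max_left _ _)
      · exact (hM' x hx hxΩ).trans (le_max_right _ _)
    · intro x hx
      have h1 : ContDiffWithinAt ℝ (0 + 1) f (closure Ω) x := by simpa using hf x hx
      obtain ⟨u, hu, -, f', hf', hc⟩ :=
        (contDiffWithinAt_succ_iff_hasFDerivWithinAt (by simp)).1 h1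
      rw [Set.insert_eq_of_mem hx] at hu
      have hxu : x ∈ u := mem_of_mem_nhdsWithin hx hu
      have hb : ∀ᶠ y in 𝓝[u] x, ‖f' y‖ < ‖f' x‖ + 1 :=
        hc.continuousWithinAt.norm.eventually_lt_const (lt_add_one _)
      have hb' : ∀ᶠ y in 𝓝[closure Ω] x, y ∈ u → ‖f' y‖ < ‖f' x‖ + 1 :=
        (eventually_nhdsWithin_iff.1 hb).filter_mono nhdsWithin_le_nhds
      have hu' : ∀ᶠ y in 𝓝[closure Ω] x, ∀ᶠ z in 𝓝[closure Ω] y, z ∈ u :=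
        eventually_eventually_nhdsWithin.2 hu
      refine ⟨{y | (y ∈ u → ‖f' y‖ < ‖f' x‖ + 1) ∧ ∀ᶠ z in 𝓝[closure Ω] y, z ∈ u},
        hb'.and hu', ‖f' x‖ + 1, fun y hy hyΩ => ?_⟩
      have hn : closure Ω ∈ 𝓝 y := mem_of_superset (hΩ.mem_nhds hyΩ) subset_closure
      have hyu : u ∈ 𝓝 y := by
        have := hy.2
        rwa [nhdsWithin_eq_nhds.2 hn] at this
      have hyu' := mem_of_mem_nhds hyu
      rw [((hf' y hyu').hasFDerivAt hyu).fderiv]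
      exact (hy.1 hyu').le
  obtain ⟨M, hM⟩ := key
  exact ⟨M, fun x hx => hM x (subset_closure hx) hx⟩

/-- Functions that are `C¹` up to the boundary and `C²` inside. -/
structure IsReg (Ω : Set Pt) (f : Pt → ℝ) : Prop where
  contDiffOn_closure : ContDiffOn ℝ 1 f (closure Ω)
  contDiffOn : ContDiffOn ℝ 2 f Ω

namespace IsReg
variable {Ω : Set Pt} {f g : Pt → ℝ}

theorem mul (hf : IsReg Ω f) (hg : IsReg Ω g) : IsReg Ω (fun x => f x * g x) :=
  ⟨hf.1.mul hg.1, hf.2.mul hg.2⟩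

theorem differentiableAt (hf : IsReg Ω f) (hΩ : IsOpen Ω) {x : Pt} (hx : x ∈ Ω) :
    DifferentiableAt ℝ f x :=
  (hf.2.contDiffAt (hΩ.mem_nhds hx)).differentiableAt (by norm_num)

theorem continuousOn_pdR (hf : IsReg Ω f) (hΩ : IsOpen Ω) (i : Fin 2) :
    ContinuousOn (fun x => pdR f x i) Ω :=
  fun _ hx => (contDiffAt_pdR hΩ hf.2 hx i).continuousAt.continuousWithinAt

theorem exists_bound (hf : IsReg Ω f) (hbd : Bornology.IsBounded Ω) :
    ∃ M, ∀ x ∈ closure Ω, |f x| ≤ M :=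
  hbd.isCompact_closure.exists_bound_of_continuousOn hf.1.continuousOn

theorem exists_bound_pdR (hf : IsReg Ω f) (hΩ : IsOpen Ω) (hbd : Bornology.IsBounded Ω) :
    ∃ M, ∀ x ∈ Ω, ∀ i, |pdR f x i| ≤ M := by
  obtain ⟨M, hM⟩ := exists_bound_fderiv hΩ hbd hf.1
  refine ⟨M, fun x hx i => ?_⟩
  have := ((fderiv ℝ f x).le_opNorm (EuclideanSpace.single i (1 : ℝ)))
  simp only [PiLp.norm_single, norm_one, mul_one] at this
  exact this.trans (hM x hx)

theorem memLp (hf : IsReg Ω f) (hΩ : IsOpen Ω) (hbd : Bornology.IsBounded Ω) :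
    MemLp f 2 (volume.restrict Ω) := by
  have : IsFiniteMeasure (volume.restrict Ω) := ⟨by
    rw [Measure.restrict_apply_univ]; exact hbd.measure_lt_top⟩
  obtain ⟨M, hM⟩ := hf.exists_bound hbd
  exact MemLp.of_bound (hf.2.continuousOn.aestronglyMeasurable hΩ.measurableSet) M
    ((ae_restrict_iff' hΩ.measurableSet).2 (ae_of_all _ fun x hx => hM x (subset_closure hx)))

theorem memLp_pdR (hf : IsReg Ω f) (hΩ : IsOpen Ω) (hbd : Bornology.IsBounded Ω) (i : Fin 2) :
    MemLp (fun x => pdR f x i) 2 (volume.restrict Ω) := by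
  have : IsFiniteMeasure (volume.restrict Ω) := ⟨by
    rw [Measure.restrict_apply_univ]; exact hbd.measure_lt_top⟩
  obtain ⟨M, hM⟩ := hf.exists_bound_pdR hΩ hbd
  exact MemLp.of_bound ((hf.continuousOn_pdR hΩ i).aestronglyMeasurable hΩ.measurableSet) M
    ((ae_restrict_iff' hΩ.measurableSet).2 (ae_of_all _ fun x hx => hM x hx i))

theorem integrableOn_gradSqR (hf : IsReg Ω f) (hΩ : IsOpen Ω) (hbd : Bornology.IsBounded Ω) :
    IntegrableOn (gradSqR f) Ω :=
  integrable_finsetSum _ fun i _ => (hf.memLp_pdR hΩ hbd i).integrable_sq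

end IsReg

/-- A smooth function vanishing near `0` and equal to the identity near infinity. -/
theorem exists_cutoff : ∃ S : ℝ → ℝ, ContDiff ℝ 2 S ∧ (∀ s, |s| ≤ 1 → S s = 0) ∧
    (∀ s, 2 < |s| → S s = s ∧ deriv S s = 1) ∧ (∀ s, |S s| ≤ |s|) ∧ ∃ L, ∀ s, |deriv S s| ≤ L := by
  set S : ℝ → ℝ := fun s => s * Real.smoothTransition (s ^ 2 - 1) with hS
  have hcd : ContDiff ℝ 2 S := by
    have : ContDiff ℝ 2 Real.smoothTransition := Real.smoothTransition.contDiff (n := 2)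
    fun_prop
  have hid : ∀ s, 2 < |s| → S s = s := fun s hs => by
    have : 1 ≤ s ^ 2 - 1 := by nlinarith [sq_abs s]
    simp [hS, Real.smoothTransition.one_of_one_le this]
  have hder : ∀ s, 2 < |s| → deriv S s = 1 := fun s hs => by
    have : S =ᶠ[𝓝 s] id := by
      filter_upwards [(isOpen_lt continuous_const continuous_abs).mem_nhds hs] with t ht
      exact hid t ht
    rw [this.deriv_eq, deriv_id]
  refine ⟨S, hcd, fun s hs => ?_, fun s hs => ⟨hid s hs, hder s hs⟩, fun s => ?_, ?_⟩
  · have : s ^ 2 - 1 ≤ 0 := by nlinarith [sq_abs s, abs_nonneg s]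
    simp [hS, Real.smoothTransition.zero_of_nonpos this]
  · rw [hS, abs_mul, abs_of_nonneg (Real.smoothTransition.nonneg _)]
    exact mul_le_of_le_one_right (abs_nonneg _) (Real.smoothTransition.le_one _)
  · obtain ⟨L, hL⟩ := (isCompact_Icc (a := (-2 : ℝ)) (b := 2)).exists_bound_of_continuousOn
      (hcd.continuous_deriv (by norm_num)).continuousOn
    refine ⟨max L 1, fun s => ?_⟩
    by_cases hs : 2 < |s|
    · simp [hder s hs]
    · exact (hL s (abs_le.1 (not_lt.1 hs))).trans (le_max_left _ _)

/-- Regular functions vanishing on the boundary. -/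
structure IsReg₀ (Ω : Set Pt) (f : Pt → ℝ) : Prop extends IsReg Ω f where
  eq_zero : ∀ x ∈ frontier Ω, f x = 0

theorem isTest_truncation {Ω : Set Pt} (hΩ : IsOpen Ω) (hbd : Bornology.IsBounded Ω) {h : Pt → ℝ}
    (hh : IsReg₀ Ω h) {S : ℝ → ℝ} (hS : ContDiff ℝ 2 S) (hS0 : ∀ s, |s| ≤ 1 → S s = 0) (c : ℝ) :
    IsTest Ω (Ω.indicator fun x => c⁻¹ * S (c * h x)) := by
  set k := Ω.indicator fun x => c⁻¹ * S (c * h x) with hk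
  set Z := closure Ω ∩ h ⁻¹' {t | 1 ≤ |c * t|} with hZ
  have hZc : IsClosed Z := hh.1.1.continuousOn.preimage_isClosed_of_isClosed isClosed_closure
    (isClosed_le continuous_const (by fun_prop))
  have hZΩ : Z ⊆ Ω := fun x hx => by
    by_contra hxΩ
    have hz := hh.eq_zero x (by rw [frontier, hΩ.interior_eq]; exact ⟨hx.1, hxΩ⟩)
    have := hx.2
    simp [hz] at this
    linarith
  have hsupp : Function.support k ⊆ Z := fun x hx => by
    have hxΩ : x ∈ Ω := by
      by_contra h'
      exact hx (by simp [hk, h'])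
    refine ⟨subset_closure hxΩ, ?_⟩
    by_contra h'
    simp only [Set.mem_preimage, Set.mem_ofPred_eq, not_le] at h'
    exact hx (by simp [hk, hxΩ, hS0 _ h'.le])
  have hts : tsupport k ⊆ Z := closure_minimal hsupp hZc
  refine ⟨contDiff_iff_contDiffAt.2 fun x => ?_,
    (hbd.isCompact_closure.of_isClosed_subset hZc Set.inter_subset_left).of_isClosed_subset
      (isClosed_tsupport _) hts, hts.trans hZΩ⟩
  by_cases hx : x ∈ Ω
  · have e : k =ᶠ[𝓝 x] fun x => c⁻¹ * S (c * h x) := by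
      filter_upwards [hΩ.mem_nhds hx] with y hy
      simp [hk, hy]
    refine ContDiffAt.congr_of_eventuallyEq ?_ e
    have := hh.1.2.contDiffAt (hΩ.mem_nhds hx)
    exact contDiffAt_const.mul (hS.contDiffAt.comp x (contDiffAt_const.mul this))
  · have e : k =ᶠ[𝓝 x] fun _ => 0 := by
      filter_upwards [hZc.isOpen_compl.mem_nhds fun h' => hx (hZΩ h')] with y hy
      exact Function.notMem_support.1 fun h' => hy (hsupp h')
    exact contDiffAt_const.congr_of_eventuallyEq e

theorem pdR_truncation {Ω : Set Pt} (hΩ : IsOpen Ω) {h : Pt → ℝ} (hh : IsReg Ω h) {S : ℝ → ℝ}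
    (hS : ContDiff ℝ 2 S) {c : ℝ} (hc : 0 < c) {x : Pt} (hx : x ∈ Ω) (i : Fin 2) :
    pdR (Ω.indicator fun x => c⁻¹ * S (c * h x)) x i = deriv S (c * h x) * pdR h x i := by
  have e : (Ω.indicator fun x => c⁻¹ * S (c * h x)) =ᶠ[𝓝 x] fun x => c⁻¹ * S (c * h x) := by
    filter_upwards [hΩ.mem_nhds hx] with y hy
    simp [hy]
  have h1 : HasFDerivAt h (fderiv ℝ h x) x := (hh.differentiableAt hΩ hx).hasFDerivAt
  have h2 : HasDerivAt S (deriv S (c * h x)) (c * h x) :=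
    (hS.differentiable (by norm_num) _).hasDerivAt
  have h3 := (h2.comp_hasFDerivAt x (h1.const_mul c)).const_mul c⁻¹
  rw [pdR, e.fderiv_eq]
  have h4 : HasFDerivAt (fun x => c⁻¹ * S (c * h x)) _ x := h3
  rw [h4.fderiv]
  simp only [smul_apply, smul_eq_mul, pdR]
  field_simp

/-- Regular functions vanishing on the boundary are approximated in `H¹` by test functions. -/
theorem IsReg₀.exists_isTest_near {Ω : Set Pt} (hΩ : IsOpen Ω) (hbd : Bornology.IsBounded Ω)
    {h : Pt → ℝ} (hh : IsReg₀ Ω h) {η : ℝ} (hη : 0 < η) :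
    ∃ k, IsTest Ω k ∧ ∫ x in Ω, (h x - k x) ^ 2 ≤ η ∧
      ∀ i, ∫ x in Ω, (pdR h x i - pdR k x i) ^ 2 ≤ η := by
  obtain ⟨S, hS, hS0, hS2, hSabs, L, hL⟩ := exists_cutoff
  set k : ℕ → Pt → ℝ := fun n => Ω.indicator fun x => ((n : ℝ) + 1)⁻¹ * S (((n : ℝ) + 1) * h x)
    with hk
  have hpos : ∀ n : ℕ, (0 : ℝ) < (n : ℝ) + 1 := fun n => by positivity
  have hkt : ∀ n, IsTest Ω (k n) := fun n => isTest_truncation hΩ hbd hh hS hS0 _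
  have hkd : ∀ n, ∀ x ∈ Ω, ∀ i, pdR (k n) x i = deriv S (((n : ℝ) + 1) * h x) * pdR h x i :=
    fun n x hx i => pdR_truncation hΩ hh.1 hS (hpos n) hx i
  have hkx : ∀ n, ∀ x ∈ Ω, k n x = ((n : ℝ) + 1)⁻¹ * S (((n : ℝ) + 1) * h x) := fun n x hx => by
    simp [hk, hx]
  have hbig : ∀ x, h x ≠ 0 → ∀ᶠ n : ℕ in atTop, 2 < |((n : ℝ) + 1) * h x| := fun x hx => by
    have : Tendsto (fun n : ℕ => ((n : ℝ) + 1) * |h x|) atTop atTop :=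
      (tendsto_atTop_add_const_right _ _ tendsto_natCast_atTop_atTop).atTop_mul_const
        (abs_pos.2 hx)
    filter_upwards [this.eventually_gt_atTop 2] with n hn
    rwa [abs_mul, abs_of_pos (hpos n)]
  have hm := hh.1.memLp hΩ hbd
  have t1 : Tendsto (fun n => ∫ x in Ω, (h x - k n x) ^ 2) atTop (𝓝 0) := by
    have := tendsto_integral_of_dominated_convergence (μ := volume.restrict Ω)
      (F := fun n x => (h x - k n x) ^ 2) (f := fun _ => 0) (fun x => 4 * h x ^ 2)
      (fun n => (hm.sub ((hkt n).memLp.restrict Ω)).integrable_sq.1) (hm.integrable_sq.const_mul 4)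
      (fun n => (ae_restrict_iff' hΩ.measurableSet).2 (ae_of_all _ fun x hx => by
        have h1 : |k n x| ≤ |h x| := by
          rw [hkx n x hx, abs_mul, abs_of_pos (inv_pos.2 (hpos n)), inv_mul_le_iff₀ (hpos n)]
          refine (hSabs _).trans_eq ?_
          rw [abs_mul, abs_of_pos (hpos n)]
        have h2 : |h x - k n x| ≤ 2 * |h x| := by linarith [abs_sub (h x) (k n x)]
        rw [Real.norm_eq_abs, abs_pow, ← sq_abs (h x)]
        calc _ ≤ (2 * |h x|) ^ 2 := by gcongr
          _ = _ := by ring))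
      ((ae_restrict_iff' hΩ.measurableSet).2 (ae_of_all _ fun x hx => by
        refine tendsto_const_nhds.congr' ?_
        by_cases hx0 : h x = 0
        · refine Eventually.of_forall fun n => ?_
          simp [hkx n x hx, hx0, hS0]
        · filter_upwards [hbig x hx0] with n hn
          have := (hpos n).ne'
          rw [hkx n x hx, (hS2 _ hn).1]
          field_simp
          simp))
    simpa using this
  have t2 : ∀ i, Tendsto (fun n => ∫ x in Ω, (pdR h x i - pdR (k n) x i) ^ 2) atTop (𝓝 0) := by
    intro i
    have hmi := hh.1.memLp_pdR hΩ hbd i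
    have := tendsto_integral_of_dominated_convergence (μ := volume.restrict Ω)
      (F := fun n x => (pdR h x i - pdR (k n) x i) ^ 2) (f := fun _ => 0)
      (fun x => (1 + L) ^ 2 * pdR h x i ^ 2)
      (fun n => (hmi.sub (((hkt n).memLp_pdR i).restrict Ω)).integrable_sq.1)
      (hmi.integrable_sq.const_mul _)
      (fun n => (ae_restrict_iff' hΩ.measurableSet).2 (ae_of_all _ fun x hx => by
        rw [hkd n x hx, Real.norm_eq_abs, abs_pow, ← sq_abs (pdR h x i), ← mul_pow]
        gcongr
        have e : pdR h x i - deriv S (((n : ℝ) + 1) * h x) * pdR h x i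
          = (1 - deriv S (((n : ℝ) + 1) * h x)) * pdR h x i := by ring
        rw [e, abs_mul]
        gcongr
        have := abs_sub 1 (deriv S (((n : ℝ) + 1) * h x))
        have := hL (((n : ℝ) + 1) * h x)
        rw [abs_one] at *
        linarith))
      (by
        rw [ae_restrict_iff' hΩ.measurableSet]
        filter_upwards [ae_pdR_eq_zero_of_eq_zero hΩ
          (fun x hx => (hh.1.differentiableAt hΩ hx).differentiableWithinAt) i] with x hx0 hx
        refine tendsto_const_nhds.congr' ?_
        by_cases hz : h x = 0
        · refine Eventually.of_forall fun n => ?_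
          simp [hkd n x hx, hx0 hx hz]
        · filter_upwards [hbig x hz] with n hn
          rw [hkd n x hx, (hS2 _ hn).2]
          simp)
    simpa using this
  obtain ⟨n, h1, h2, h3⟩ := ((t1.eventually_le_const hη).and
    (((t2 0).eventually_le_const hη).and ((t2 1).eventually_le_const hη))).exists
  refine ⟨k n, hkt n, h1, fun i => ?_⟩
  fin_cases i
  exacts [h2, h3]

theorem IsTest.pdR_eq_zero {Ω : Set Pt} {h : Pt → ℝ} (hh : IsTest Ω h) {x : Pt} (hx : x ∉ Ω)
    (i : Fin 2) : pdR h x i = 0 := by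
  rw [pdR, fderiv_of_notMem_tsupport (𝕜 := ℝ) fun h' => hx (hh.subset h')]
  rfl

theorem IsReg₀.exists_isTest_seq {Ω : Set Pt} (hΩ : IsOpen Ω) (hbd : Bornology.IsBounded Ω)
    {h : ℕ → Pt → ℝ} (hh : ∀ n, IsReg₀ Ω (h n)) :
    ∃ k : ℕ → Pt → ℝ, (∀ n, IsTest Ω (k n)) ∧
      Tendsto (fun n => ∫ x in Ω, (h n x - k n x) ^ 2) atTop (𝓝 0) ∧
      ∀ i, Tendsto (fun n => ∫ x in Ω, (pdR (h n) x i - pdR (k n) x i) ^ 2) atTop (𝓝 0) := by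
  choose k hk h1 h2 using fun n : ℕ =>
    (hh n).exists_isTest_near hΩ hbd (Nat.one_div_pos_of_nat (α := ℝ) (n := n))
  exact ⟨k, hk, squeeze_zero (fun n => integral_nonneg fun x => sq_nonneg _) h1
    tendsto_one_div_add_atTop_nhds_zero_nat, fun i => squeeze_zero
    (fun n => integral_nonneg fun x => sq_nonneg _) (fun n => h2 n i)
    tendsto_one_div_add_atTop_nhds_zero_nat⟩

/-- The gradient of a harmonic function is orthogonal to gradients of functions vanishing on the
boundary. -/
theorem integral_inner_grad_eq_zero {Ω : Set Pt} (hΩ : IsOpen Ω) (hbd : Bornology.IsBounded Ω)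
    {φ h : Pt → ℝ} (hφ : IsReg Ω φ) (hharm : ∀ x ∈ Ω, lapR φ x = 0) (hh : IsReg₀ Ω h) :
    ∫ x in Ω, ∑ i, pdR φ x i * pdR h x i = 0 := by
  obtain ⟨k, hk, -, h2⟩ := IsReg₀.exists_isTest_seq hΩ hbd (fun _ : ℕ => hh)
  have hφi := fun i => hφ.memLp_pdR hΩ hbd i
  have hhi := fun i => hh.1.memLp_pdR hΩ hbd i
  have hki := fun n i => ((hk n).memLp_pdR i).restrict Ω
  have hint : ∀ i, Integrable (fun x => pdR φ x i * pdR h x i) (volume.restrict Ω) := fun i =>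
    (hφi i).integrable_mul (hhi i)
  have hzero : ∀ n, ∑ i, ∫ x in Ω, pdR φ x i * pdR (k n) x i = 0 := fun n => by
    have hp := fun i => integral_mul_pdR_eq_neg hΩ (f := fun x => pdR φ x i) (i := i)
      (fun x hx => (contDiffAt_pdR hΩ hφ.2 hx i).differentiableAt (by norm_num))
      (fun x hx => by
        have := (contDiffAt_pdR hΩ hφ.2 hx i).fderiv_right (m := 0) (by norm_num)
        exact (this.continuousAt.clm_apply continuousAt_const).continuousWithinAt)
      ((hk n).contDiff.of_le (by norm_num)) (hk n).compact (hk n).subset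
    have e : ∀ i, ∫ x in Ω, pdR φ x i * pdR (k n) x i = ∫ x, pdR φ x i * pdR (k n) x i := fun i =>
      setIntegral_eq_integral_of_forall_compl_eq_zero fun x hx => by simp [(hk n).pdR_eq_zero hx]
    have hs : ∑ i, ∫ x, k n x * pdR (fun y => pdR φ y i) x i = 0 := by
      rw [← integral_finsetSum _ fun i _ => (hp i).1]
      refine integral_eq_zero_of_ae (ae_of_all _ fun x => ?_)
      by_cases hx : x ∈ Ω
      · simp only [← Finset.mul_sum]
        exact mul_eq_zero_of_right _ (hharm x hx)
      · simp [(hk n).eq_zero hx]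
    simp only [e]
    simp only [(hp _).2.2, Finset.sum_neg_distrib, neg_eq_zero] at hs
    exact hs
  have ht : ∀ i, Tendsto (fun n => ∫ x in Ω, pdR φ x i * pdR (k n) x i) atTop
      (𝓝 (∫ x in Ω, pdR φ x i * pdR h x i)) := fun i => by
    have := tendsto_integral_mul_mul_zero (l := atTop) (μ := volume.restrict Ω)
      (k := fun _ : Pt => (1 : ℝ)) (M := 1)
      aestronglyMeasurable_const (fun _ => by simp) (fun n => (hhi i).sub (hki n i))
      (fun _ : ℕ => hφi i) (h2 i) (Eventually.of_forall fun _ => le_rfl)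
    have h3 := this.const_sub (∫ x in Ω, pdR φ x i * pdR h x i)
    rw [sub_zero] at h3
    refine h3.congr fun n => ?_
    have h4 : Integrable (fun x => pdR φ x i * pdR (k n) x i) (volume.restrict Ω) :=
      (hφi i).integrable_mul (hki n i)
    rw [sub_eq_iff_eq_add, ← sub_eq_iff_eq_add', ← integral_sub (hint i) h4]
    refine integral_congr_ae (ae_of_all _ fun x => ?_)
    simp
    ring
  rw [integral_finsetSum _ fun i _ => hint i]
  exact tendsto_nhds_unique (tendsto_finsetSum _ fun i _ => ht i)
    (by simp [hzero])

theorem integral_sq_le_two_mul {α : Type*} {m : MeasurableSpace α} {μ : Measure α} {f g : α → ℝ}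
    (hf : MemLp f 2 μ) (hg : MemLp g 2 μ) :
    ∫ x, f x ^ 2 ∂μ ≤ 2 * (∫ x, g x ^ 2 ∂μ) + 2 * ∫ x, (f x - g x) ^ 2 ∂μ := by
  have h1 := (hf.sub hg).integrable_sq
  simp only [Pi.sub_apply] at h1
  rw [← integral_const_mul, ← integral_const_mul,
    ← integral_add (hg.integrable_sq.const_mul 2) (h1.const_mul 2)]
  refine integral_mono hf.integrable_sq
    ((hg.integrable_sq.const_mul 2).add (h1.const_mul 2)) fun x => ?_
  nlinarith [sq_nonneg (f x - 2 * g x)]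

theorem integral_gradSqR_eq {μ : Measure Pt} {h : Pt → ℝ}
    (hh : ∀ i, MemLp (fun x => pdR h x i) 2 μ) :
    ∫ x, gradSqR h x ∂μ = ∑ i, ∫ x, pdR h x i ^ 2 ∂μ :=
  integral_finsetSum _ fun i _ => (hh i).integrable_sq

theorem integral_gradSqR_le {Ω : Set Pt} (hΩ : IsOpen Ω) (hbd : Bornology.IsBounded Ω)
    {h k : Pt → ℝ} (hh : IsReg Ω h) (hk : IsTest Ω k) :
    ∫ x, gradSqR k x ≤ 2 * (∫ x in Ω, gradSqR h x) +
      2 * ∑ i, ∫ x in Ω, (pdR h x i - pdR k x i) ^ 2 := by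
  have e : ∫ x in Ω, gradSqR k x = ∫ x, gradSqR k x :=
    setIntegral_eq_integral_of_forall_compl_eq_zero fun x hx => by
      simp [gradSqR, hk.pdR_eq_zero hx]
  rw [← e, integral_gradSqR_eq fun i => (hk.memLp_pdR i).restrict Ω,
    integral_gradSqR_eq fun i => hh.memLp_pdR hΩ hbd i, Finset.mul_sum, Finset.mul_sum,
    ← Finset.sum_add_distrib]
  refine Finset.sum_le_sum fun i _ => ?_
  have := integral_sq_le_two_mul ((hk.memLp_pdR i).restrict Ω) (hh.memLp_pdR hΩ hbd i)
  simpa only [sub_sq_comm (pdR k _ i)] using this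

/-- Poincaré inequality for functions vanishing on the boundary. -/
theorem IsReg₀.exists_poincare {Ω : Set Pt} (hΩ : IsOpen Ω) (hbd : Bornology.IsBounded Ω) :
    ∃ C, 0 ≤ C ∧ ∀ h, IsReg₀ Ω h → ∫ x in Ω, h x ^ 2 ≤ C * ∫ x in Ω, gradSqR h x := by
  obtain ⟨C, hC, hP⟩ := _root_.exists_poincare hbd
  refine ⟨4 * C, by positivity, fun h hh => ?_⟩
  obtain ⟨k, hk, h1, h2⟩ := IsReg₀.exists_isTest_seq hΩ hbd (fun _ : ℕ => hh)
  have ht := ((tendsto_finsetSum Finset.univ fun i _ => h2 i).const_mul (4 * C)).add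
    (h1.const_mul 2)
  have ht' := ht.const_add (4 * C * ∫ x in Ω, gradSqR h x)
  simp only [Finset.sum_const_zero, mul_zero, add_zero] at ht'
  refine ge_of_tendsto' ht' fun n => ?_
  have a1 := integral_sq_le_two_mul (hh.1.memLp hΩ hbd) ((hk n).memLp.restrict Ω)
  have a2 : ∫ x in Ω, k n x ^ 2 = ∫ x, k n x ^ 2 :=
    setIntegral_eq_integral_of_forall_compl_eq_zero fun x hx => by simp [(hk n).eq_zero hx]
  have a3 := hP _ (hk n)
  have a4 := mul_le_mul_of_nonneg_left (integral_gradSqR_le hΩ hbd hh.1 (hk n)) hC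
  linarith

theorem tendsto_integral_abs_mul_zero {X ι : Type*} [MeasurableSpace X] {μ : Measure X}
    {l : Filter ι} {f g : ι → X → ℝ} {C : ℝ} (hf : ∀ n, MemLp (f n) 2 μ)
    (hg : ∀ n, MemLp (g n) 2 μ) (hf0 : Tendsto (fun n => ∫ x, f n x ^ 2 ∂μ) l (𝓝 0))
    (hC : ∀ᶠ n in l, ∫ x, g n x ^ 2 ∂μ ≤ C) :
    Tendsto (fun n => ∫ x, |f n x| * |g n x| ∂μ) l (𝓝 0) := by
  simpa using tendsto_integral_mul_mul_zero (k := fun _ : X => (1 : ℝ)) (M := 1)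
    aestronglyMeasurable_const (fun _ => by simp) (fun n => (hf n).abs) (fun n => (hg n).abs)
    (by simpa using hf0) (by simpa using hC)

theorem tendsto_integral_abs_zero {X ι : Type*} [MeasurableSpace X] {μ : Measure X}
    [IsFiniteMeasure μ] {l : Filter ι} {f : ι → X → ℝ} (hf : ∀ n, MemLp (f n) 2 μ)
    (hf0 : Tendsto (fun n => ∫ x, f n x ^ 2 ∂μ) l (𝓝 0)) :
    Tendsto (fun n => ∫ x, |f n x| ∂μ) l (𝓝 0) := by
  simpa using tendsto_integral_abs_mul_zero hf (g := fun _ _ => (1 : ℝ))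
    (fun _ => memLp_const 1) hf0 (Eventually.of_forall fun _ => le_rfl)

theorem isFiniteMeasure_restrict {Ω : Set Pt} (hbd : Bornology.IsBounded Ω) :
    IsFiniteMeasure (volume.restrict Ω) :=
  ⟨by rw [Measure.restrict_apply_univ]; exact hbd.measure_lt_top⟩

/-- The constraint `|1 + α + ib|² = 1` passes to `L²`-nearby sequences. -/
theorem tendsto_integral_abs_constraint {X : Type*} [MeasurableSpace X] {μ : Measure X}
    [IsFiniteMeasure μ] {α b α' b' : ℕ → X → ℝ} {C : ℝ} (hα : ∀ n, MemLp (α n) 2 μ)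
    (hb : ∀ n, MemLp (b n) 2 μ) (hα' : ∀ n, MemLp (α' n) 2 μ) (hb' : ∀ n, MemLp (b' n) 2 μ)
    (hαC : ∀ n, ∫ x, α n x ^ 2 ∂μ ≤ C) (hbC : ∀ n, ∫ x, b n x ^ 2 ∂μ ≤ C)
    (hd : Tendsto (fun n => ∫ x, (α n x - α' n x) ^ 2 ∂μ) atTop (𝓝 0))
    (he : Tendsto (fun n => ∫ x, (b n x - b' n x) ^ 2 ∂μ) atTop (𝓝 0))
    (hc : Tendsto (fun n => ∫ x, |2 * α n x + α n x ^ 2 + b n x ^ 2| ∂μ) atTop (𝓝 0)) :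
    Tendsto (fun n => ∫ x, |2 * α' n x + α' n x ^ 2 + b' n x ^ 2| ∂μ) atTop (𝓝 0) := by
  have md := fun n => (hα n).sub (hα' n)
  have me := fun n => (hb n).sub (hb' n)
  have t1 := tendsto_integral_abs_zero md hd
  have t2 := tendsto_integral_abs_mul_zero md hα hd (Eventually.of_forall hαC)
  have t3 := tendsto_integral_abs_mul_zero me hb he (Eventually.of_forall hbC)
  have t := ((((hc.add (t1.const_mul 2)).add (t2.const_mul 2)).add (t3.const_mul 2)).add hd).add he
  simp only [mul_zero, add_zero] at t
  refine squeeze_zero (fun n => integral_nonneg fun x => abs_nonneg _) (fun n => ?_) t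
  have i0 : Integrable (fun x => |2 * α n x + α n x ^ 2 + b n x ^ 2|) μ :=
    (((((hα n).integrable (by norm_num)).const_mul 2).add (hα n).integrable_sq).add
      (hb n).integrable_sq).abs
  have i1 : Integrable (fun x => |(α n - α' n) x|) μ := ((md n).integrable (by norm_num)).abs
  have i2 : Integrable (fun x => |(α n - α' n) x| * |α n x|) μ :=
    (md n).abs.integrable_mul (hα n).abs
  have i3 : Integrable (fun x => |(b n - b' n) x| * |b n x|) μ := (me n).abs.integrable_mul (hb n).abs
  have i4 : Integrable (fun x => (α n x - α' n x) ^ 2) μ := (md n).integrable_sq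
  have i5 : Integrable (fun x => (b n x - b' n x) ^ 2) μ := (me n).integrable_sq
  have j1 := i0.fun_add (i1.const_mul 2)
  have j2 := j1.fun_add (i2.const_mul 2)
  have j3 := j2.fun_add (i3.const_mul 2)
  have j4 := j3.fun_add i4
  rw [← integral_const_mul, ← integral_const_mul, ← integral_const_mul,
    ← integral_add i0 (i1.const_mul 2), ← integral_add j1 (i2.const_mul 2),
    ← integral_add j2 (i3.const_mul 2), ← integral_add j3 i4, ← integral_add j4 i5]
  refine integral_mono_of_nonneg (ae_of_all _ fun x => abs_nonneg _) (j4.fun_add i5)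
    (ae_of_all _ fun x => ?_)
  simp only [Pi.sub_apply]
  rw [← abs_mul, ← abs_mul]
  have e : 2 * α' n x + α' n x ^ 2 + b' n x ^ 2 = (2 * α n x + α n x ^ 2 + b n x ^ 2)
    - 2 * (α n x - α' n x) - 2 * ((α n x - α' n x) * α n x) - 2 * ((b n x - b' n x) * b n x)
    + (α n x - α' n x) ^ 2 + (b n x - b' n x) ^ 2 := by ring
  rw [e, abs_le]
  generalize 2 * α n x + α n x ^ 2 + b n x ^ 2 = p
  generalize hq : (α n x - α' n x) = q
  generalize q * α n x = r
  generalize hs : (b n x - b' n x) = s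
  generalize s * b n x = t
  have := sq_nonneg q
  have := sq_nonneg s
  constructor <;> linarith [neg_abs_le p, le_abs_self p, neg_abs_le q, le_abs_self q,
    neg_abs_le r, le_abs_self r, neg_abs_le t, le_abs_self t]

theorem IsTest.isReg {Ω : Set Pt} {h : Pt → ℝ} (hh : IsTest Ω h) : IsReg Ω h :=
  ⟨(hh.contDiff.of_le (by norm_num)).contDiffOn, hh.contDiff.contDiffOn⟩

theorem IsReg.integral_pdR_sq_le {Ω : Set Pt} (hΩ : IsOpen Ω) (hbd : Bornology.IsBounded Ω)
    {h : Pt → ℝ} (hh : IsReg Ω h) (i : Fin 2) :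
    ∫ x in Ω, pdR h x i ^ 2 ≤ ∫ x in Ω, gradSqR h x :=
  integral_mono (hh.memLp_pdR hΩ hbd i).integrable_sq (hh.integrableOn_gradSqR hΩ hbd) fun x =>
    Finset.single_le_sum (f := fun i => pdR h x i ^ 2) (fun _ _ => sq_nonneg _) (Finset.mem_univ i)

/-- The coupling term `∫ b ∇φ · ∇α` vanishes along a subsequence. -/
theorem exists_subseq_tendsto_inner_grad {Ω : Set Pt} (hΩ : IsOpen Ω) (hne : Ω.Nonempty)
    (hbd : Bornology.IsBounded Ω) (hstar : ∃ x₀, StarConvex ℝ x₀ Ω) {φ : Pt → ℝ} (hφ : IsReg Ω φ)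
    (hharm : ∀ x ∈ Ω, lapR φ x = 0) {α b : ℕ → Pt → ℝ} {C : ℝ} (hα : ∀ n, IsReg₀ Ω (α n))
    (hb : ∀ n, IsReg₀ Ω (b n)) (hαC : ∀ n, ∫ x in Ω, gradSqR (α n) x ≤ C)
    (hbC : ∀ n, ∫ x in Ω, gradSqR (b n) x ≤ C)
    (hc : Tendsto (fun n => ∫ x in Ω, |2 * α n x + α n x ^ 2 + b n x ^ 2|) atTop (𝓝 0)) :
    ∃ σ : ℕ → ℕ, StrictMono σ ∧ Tendsto (fun n => ∫ x in Ω, b (σ n) x *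
      ∑ i, pdR φ x i * pdR (α (σ n)) x i) atTop (𝓝 0) := by
  have hfin := isFiniteMeasure_restrict hbd
  obtain ⟨M, hM⟩ := hφ.exists_bound_pdR hΩ hbd
  obtain ⟨f, K, hf⟩ := exists_harmonic_conjugate hΩ hne hbd hstar hφ.2 hharm hM
  obtain ⟨Cp, hCp0, hCp⟩ := IsReg₀.exists_poincare hΩ hbd
  obtain ⟨α', hα', dα, dα'⟩ := IsReg₀.exists_isTest_seq hΩ hbd hα
  obtain ⟨b', hb', db, db'⟩ := IsReg₀.exists_isTest_seq hΩ hbd hb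
  have mα := fun n => (hα n).1.memLp hΩ hbd
  have mb := fun n => (hb n).1.memLp hΩ hbd
  have mα' := fun n => (hα' n).isReg.memLp hΩ hbd
  have mb' := fun n => (hb' n).isReg.memLp hΩ hbd
  have mdα := fun n i => (hα n).1.memLp_pdR hΩ hbd i
  have mdα' := fun n i => (hα' n).isReg.memLp_pdR hΩ hbd i
  have bound : ∀ {h k : ℕ → Pt → ℝ}, (∀ n, IsReg₀ Ω (h n)) → (∀ n, IsTest Ω (k n)) →
      (∀ n, ∫ x in Ω, gradSqR (h n) x ≤ C) →
      (∀ i, Tendsto (fun n => ∫ x in Ω, (pdR (h n) x i - pdR (k n) x i) ^ 2) atTop (𝓝 0)) →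
      ∃ B, ∀ n, ∫ x, gradSqR (k n) x ≤ B := fun {h k} hh hk hC hd => by
    have t := tendsto_finsetSum Finset.univ fun i _ => hd i
    obtain ⟨B, hB⟩ := t.bddAbove_range
    refine ⟨2 * C + 2 * B, fun n => ?_⟩
    have h1 := integral_gradSqR_le hΩ hbd (hh n).1 (hk n)
    have h2 := hB ⟨n, rfl⟩
    have h3 := hC n
    simp only at h2
    linarith
  obtain ⟨B₁, hB₁⟩ := bound hα hα' hαC dα'
  obtain ⟨B₂, hB₂⟩ := bound hb hb' hbC db'
  have L2 : ∀ {h : ℕ → Pt → ℝ}, (∀ n, IsReg₀ Ω (h n)) → (∀ n, ∫ x in Ω, gradSqR (h n) x ≤ C) →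
      ∀ n, ∫ x in Ω, h n x ^ 2 ≤ Cp * C := fun hh hC n =>
    (hCp _ (hh n)).trans (mul_le_mul_of_nonneg_left (hC n) hCp0)
  have hc' := tendsto_integral_abs_constraint mα mb mα' mb' (L2 hα hαC) (L2 hb hbC) dα db hc
  have e : ∀ n, ∫ x in Ω, |2 * α' n x + α' n x ^ 2 + b' n x ^ 2| =
      ∫ x, |2 * α' n x + α' n x ^ 2 + b' n x ^ 2| := fun n =>
    setIntegral_eq_integral_of_forall_compl_eq_zero fun x hx => by
      simp [(hα' n).eq_zero hx, (hb' n).eq_zero hx]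
  simp only [e] at hc'
  have hM' : ∀ x ∈ Ω, ∀ i, |pdR f x i| ≤ M := fun x hx i => by
    obtain ⟨-, h0, h1, -⟩ := hf x hx
    fin_cases i
    · simpa [h0] using hM x hx 1
    · simpa [h1] using hM x hx 0
  obtain ⟨σ, hσ, t⟩ := exists_subseq_tendsto_coupling hΩ hbd (fun x hx => (hf x hx).1)
    (fun i => by
      fin_cases i
      · exact (hφ.continuousOn_pdR hΩ 1).congr fun x hx => (hf x hx).2.1
      · exact (hφ.continuousOn_pdR hΩ 0).neg.congr fun x hx => (hf x hx).2.2.1)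
    (fun x hx => (hf x hx).2.2.2) hM' hα' hb' (fun n => (hB₁ n).trans (le_max_left _ _))
    (fun n => (hB₂ n).trans (le_max_right _ _)) hc'
  refine ⟨σ, hσ, ?_⟩
  set p : Fin 2 → Pt → ℝ := fun i => Ω.indicator fun x => pdR φ x i with hp
  have hpm : ∀ i, AEStronglyMeasurable (p i) (volume.restrict Ω) := fun i =>
    ((hφ.continuousOn_pdR hΩ i).aestronglyMeasurable hΩ.measurableSet).indicator hΩ.measurableSet
  have hM0 : 0 ≤ M := by
    obtain ⟨x, hx⟩ := hne
    exact (abs_nonneg _).trans (hM x hx 0)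
  have hpM : ∀ i x, |p i x| ≤ M := fun i x => by
    by_cases hx : x ∈ Ω
    · simpa [hp, hx] using hM x hx i
    · simpa [hp, hx] using hM0
  have t1 := fun i => tendsto_integral_mul_mul_zero (hpm i) (hpM i) (fun n => (mb n).sub (mb' n))
    (fun n => mdα n i) db (Eventually.of_forall fun n =>
      ((hα n).1.integral_pdR_sq_le hΩ hbd i).trans (hαC n))
  have hb'C : ∃ D, ∀ n, ∫ x in Ω, b' n x ^ 2 ≤ D := by
    obtain ⟨Cq, hCq0, hCq⟩ := exists_poincare hbd
    refine ⟨Cq * B₂, fun n => ?_⟩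
    rw [setIntegral_eq_integral_of_forall_compl_eq_zero
      fun x hx => by simp [(hb' n).eq_zero hx]]
    exact (hCq _ (hb' n)).trans (mul_le_mul_of_nonneg_left (hB₂ n) hCq0)
  obtain ⟨D, hD⟩ := hb'C
  have t2 := fun i => tendsto_integral_mul_mul_zero (hpm i) (hpM i)
    (fun n => (mdα n i).sub (mdα' n i)) (fun n => mb' n) (dα' i) (Eventually.of_forall hD)
  have hsum := (t.add ((tendsto_finsetSum Finset.univ fun i _ =>
    (t1 i).comp hσ.tendsto_atTop))).add (tendsto_finsetSum Finset.univ fun i _ =>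
    (t2 i).comp hσ.tendsto_atTop)
  simp only [Finset.sum_const_zero, add_zero, Function.comp_apply] at hsum
  refine hsum.congr fun n => ?_
  generalize σ n = m
  have bdd : ∀ {g h : Pt → ℝ} i, MemLp g 2 (volume.restrict Ω) → MemLp h 2 (volume.restrict Ω) →
      Integrable (fun x => p i x * g x * h x) (volume.restrict Ω) := fun {g h} i hg hh => by
    have : MemLp (fun x => p i x * g x) 2 (volume.restrict Ω) :=
      hg.of_le_mul (c := M) ((hpm i).mul hg.1) (ae_of_all _ fun x => by
        rw [norm_mul]; exact mul_le_mul_of_nonneg_right (hpM i x) (norm_nonneg _))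
    exact this.integrable_mul hh
  have hpx : ∀ x ∈ Ω, ∀ i, p i x = pdR φ x i := fun x hx i => by simp [hp, hx]
  have e1 : ∫ x in Ω, b' m x * (pdR f x 0 * pdR (α' m) x 1 - pdR f x 1 * pdR (α' m) x 0) =
      ∑ i, ∫ x in Ω, p i x * b' m x * pdR (α' m) x i := by
    rw [← integral_finsetSum _ fun i _ => bdd i (mb' m) (mdα' m i)]
    refine setIntegral_congr_fun hΩ.measurableSet fun x hx => ?_
    obtain ⟨-, h0, h1, -⟩ := hf x hx
    simp only [Fin.sum_univ_two, hpx x hx, h0, h1]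
    ring
  have e2 : ∫ x in Ω, b m x * ∑ i, pdR φ x i * pdR (α m) x i =
      ∑ i, ∫ x in Ω, p i x * b m x * pdR (α m) x i := by
    rw [← integral_finsetSum _ fun i _ => bdd i (mb m) (mdα m i)]
    refine setIntegral_congr_fun hΩ.measurableSet fun x hx => ?_
    simp only [Fin.sum_univ_two, hpx x hx]
    ring
  rw [e1, e2, ← Finset.sum_add_distrib, ← Finset.sum_add_distrib]
  refine Finset.sum_congr rfl fun i _ => ?_
  have k1 := bdd i (mb' m) (mdα' m i)
  have k2 := bdd i ((mb m).sub (mb' m)) (mdα m i)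
  have k3 := bdd i ((mdα m i).sub (mdα' m i)) (mb' m)
  rw [← integral_add k1 k2, ← integral_add (k1.fun_add k2) k3]
  refine integral_congr_ae (ae_of_all _ fun x => ?_)
  simp only [Pi.sub_apply]
  ring

/-- Polar-type decomposition of a complex-valued map relative to a phase. -/
theorem exists_isReg₀_decomposition {Ω : Set Pt} {φ : Pt → ℝ} (hφ : IsReg Ω φ) {U : Pt → ℂ}
    (hU1 : ContDiffOn ℝ 1 U (closure Ω)) (hU2 : ContDiffOn ℝ 2 U Ω)
    (hUb : ∀ x ∈ frontier Ω, U x = Complex.exp (Complex.I * (φ x : ℂ))) :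
    ∃ α b : Pt → ℝ, IsReg₀ Ω α ∧ IsReg₀ Ω b ∧
      ∀ x, U x = Complex.exp (Complex.I * (φ x : ℂ)) * (1 + α x + b x * Complex.I) := by
  have key : ∀ x, Complex.exp (Complex.I * (φ x : ℂ)) =
      (Real.cos (φ x) : ℂ) + (Real.sin (φ x) : ℂ) * Complex.I := fun x => by
    rw [mul_comm, Complex.exp_mul_I]
    push_cast
    rfl
  have re : ∀ {n : WithTop ℕ∞} {s : Set Pt}, ContDiffOn ℝ n U s →
      ContDiffOn ℝ n (fun x => (U x).re) s := fun h => Complex.reCLM.contDiff.comp_contDiffOn h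
  have im : ∀ {n : WithTop ℕ∞} {s : Set Pt}, ContDiffOn ℝ n U s →
      ContDiffOn ℝ n (fun x => (U x).im) s := fun h => Complex.imCLM.contDiff.comp_contDiffOn h
  have cs : ∀ {n : WithTop ℕ∞} {s : Set Pt}, ContDiffOn ℝ n φ s →
      ContDiffOn ℝ n (fun x => Real.cos (φ x)) s := fun h => Real.contDiff_cos.comp_contDiffOn h
  have sn : ∀ {n : WithTop ℕ∞} {s : Set Pt}, ContDiffOn ℝ n φ s →
      ContDiffOn ℝ n (fun x => Real.sin (φ x)) s := fun h => Real.contDiff_sin.comp_contDiffOn h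
  refine ⟨fun x => (U x).re * Real.cos (φ x) + (U x).im * Real.sin (φ x) - 1,
    fun x => (U x).im * Real.cos (φ x) - (U x).re * Real.sin (φ x), ⟨⟨?_, ?_⟩, ?_⟩,
    ⟨⟨?_, ?_⟩, ?_⟩, fun x => ?_⟩
  · exact (((re hU1).mul (cs hφ.1)).add ((im hU1).mul (sn hφ.1))).sub contDiffOn_const
  · exact (((re hU2).mul (cs hφ.2)).add ((im hU2).mul (sn hφ.2))).sub contDiffOn_const
  · intro x hx
    simp only [hUb x hx, key, Complex.add_re, Complex.add_im, Complex.ofReal_re, Complex.ofReal_im,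
      Complex.re_ofReal_mul, Complex.im_ofReal_mul, Complex.I_re, Complex.I_im]
    linear_combination Real.sin_sq_add_cos_sq (φ x)
  · exact ((im hU1).mul (cs hφ.1)).sub ((re hU1).mul (sn hφ.1))
  · exact ((im hU2).mul (cs hφ.2)).sub ((re hU2).mul (sn hφ.2))
  · intro x hx
    simp only [hUb x hx, key, Complex.add_re, Complex.add_im, Complex.ofReal_re, Complex.ofReal_im,
      Complex.re_ofReal_mul, Complex.im_ofReal_mul, Complex.I_re, Complex.I_im]
    ring
  · have h := Real.sin_sq_add_cos_sq (φ x)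
    rw [key]
    apply Complex.ext
    · simp [-Complex.ofReal_cos, -Complex.ofReal_sin]
      linear_combination -(U x).re * h
    · simp [-Complex.ofReal_cos, -Complex.ofReal_sin]
      linear_combination -(U x).im * h

theorem pd_exp_mul {φ α b : Pt → ℝ} {x : Pt} (hφ : DifferentiableAt ℝ φ x)
    (hα : DifferentiableAt ℝ α x) (hb : DifferentiableAt ℝ b x) (i : Fin 2) :
    pd (fun y => Complex.exp (Complex.I * (φ y : ℂ)) * (1 + α y + b y * Complex.I)) x i =
      Complex.exp (Complex.I * (φ x : ℂ)) * (((pdR α x i - pdR φ x i * b x : ℝ) : ℂ) +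
        ((pdR b x i + pdR φ x i * (1 + α x) : ℝ) : ℂ) * Complex.I) := by
  have co : ∀ {f : Pt → ℝ}, DifferentiableAt ℝ f x →
      HasFDerivAt (fun y => (f y : ℂ)) (Complex.ofRealCLM.comp (fderiv ℝ f x)) x := fun h =>
    Complex.ofRealCLM.hasFDerivAt.comp x h.hasFDerivAt
  have h1 := ((co hφ).const_mul Complex.I).cexp
  have h2 := ((co hα).const_add 1).add ((co hb).mul_const Complex.I)
  have h3 : HasFDerivAt (fun y => Complex.exp (Complex.I * (φ y : ℂ)) *
    (1 + α y + b y * Complex.I)) _ x := h1.mul h2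
  rw [pd, h3.fderiv]
  simp [pdR]
  ring_nf
  simp
  ring

theorem norm_exp_I_mul (t : ℝ) : ‖Complex.exp (Complex.I * (t : ℂ))‖ = 1 := by
  rw [mul_comm, Complex.norm_exp_ofReal_mul_I]

theorem norm_sq_exp_I_mul_mul (t a b : ℝ) :
    ‖Complex.exp (Complex.I * (t : ℂ)) * ((a : ℂ) + b * Complex.I)‖ ^ 2 = a ^ 2 + b ^ 2 := by
  rw [norm_mul, norm_exp_I_mul, one_mul, ← Complex.normSq_eq_norm_sq, Complex.normSq_add_mul_I]

theorem pd_exp {φ : Pt → ℝ} {u₀ : Pt → ℂ} (hu₀ : ∀ x, u₀ x = Complex.exp (Complex.I * (φ x : ℂ)))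
    {x : Pt} (hφ : DifferentiableAt ℝ φ x) (i : Fin 2) :
    pd u₀ x i = Complex.exp (Complex.I * (φ x : ℂ)) * ((pdR φ x i : ℝ) * Complex.I) := by
  have h := pd_exp_mul hφ (differentiableAt_const (0 : ℝ)) (differentiableAt_const (0 : ℝ)) i
  have e : u₀ = fun y => Complex.exp (Complex.I * (φ y : ℂ)) := funext hu₀
  simpa [e, pdR] using h

section Pointwise
variable {φ α b : Pt → ℝ} {U u₀ : Pt → ℂ}

theorem gradSq_exp (hu₀ : ∀ x, u₀ x = Complex.exp (Complex.I * (φ x : ℂ)))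
    {x : Pt} (hφ : DifferentiableAt ℝ φ x) : gradSq u₀ x = gradSqR φ x := by
  simp [gradSq, gradSqR, pd_exp hu₀ hφ]

theorem norm_sq_pd (hU : ∀ x, U x =
      Complex.exp (Complex.I * (φ x : ℂ)) * (1 + α x + b x * Complex.I)) {x : Pt}
    (hφ : DifferentiableAt ℝ φ x) (hα : DifferentiableAt ℝ α x) (hb : DifferentiableAt ℝ b x)
    (i : Fin 2) : ‖pd U x i‖ ^ 2 =
      (pdR α x i - pdR φ x i * b x) ^ 2 + (pdR b x i + pdR φ x i * (1 + α x)) ^ 2 := by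
  rw [funext hU, pd_exp_mul hφ hα hb, norm_sq_exp_I_mul_mul]

theorem norm_sq_pd_sub (hU : ∀ x, U x =
      Complex.exp (Complex.I * (φ x : ℂ)) * (1 + α x + b x * Complex.I))
    (hu₀ : ∀ x, u₀ x = Complex.exp (Complex.I * (φ x : ℂ))) {x : Pt}
    (hφ : DifferentiableAt ℝ φ x) (hα : DifferentiableAt ℝ α x) (hb : DifferentiableAt ℝ b x)
    (i : Fin 2) : ‖pd U x i - pd u₀ x i‖ ^ 2 =
      (pdR α x i - pdR φ x i * b x) ^ 2 + (pdR b x i + pdR φ x i * α x) ^ 2 := by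
  rw [funext hU, pd_exp_mul hφ hα hb, pd_exp hu₀ hφ, ← norm_sq_exp_I_mul_mul (φ x)]
  congr 2
  push_cast
  ring

theorem norm_sq_eq (hU : ∀ x, U x =
      Complex.exp (Complex.I * (φ x : ℂ)) * (1 + α x + b x * Complex.I)) (x : Pt) :
    ‖U x‖ ^ 2 = 1 + (2 * α x + α x ^ 2 + b x ^ 2) := by
  have := norm_sq_exp_I_mul_mul (φ x) (1 + α x) (b x)
  rw [hU, ← Complex.ofReal_one, ← Complex.ofReal_add, this]
  ring

theorem norm_sq_sub_eq (hU : ∀ x, U x =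
      Complex.exp (Complex.I * (φ x : ℂ)) * (1 + α x + b x * Complex.I))
    (hu₀ : ∀ x, u₀ x = Complex.exp (Complex.I * (φ x : ℂ))) (x : Pt) :
    ‖U x - u₀ x‖ ^ 2 = α x ^ 2 + b x ^ 2 := by
  rw [← norm_sq_exp_I_mul_mul (φ x), hU, hu₀]
  congr 2
  ring

theorem gradSq_eq (hU : ∀ x, U x =
      Complex.exp (Complex.I * (φ x : ℂ)) * (1 + α x + b x * Complex.I)) {x : Pt}
    (hφ : DifferentiableAt ℝ φ x) (hα : DifferentiableAt ℝ α x) (hb : DifferentiableAt ℝ b x) :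
    gradSq U x = gradSqR α x + gradSqR b x + gradSqR φ x
      + (2 * α x + α x ^ 2 + b x ^ 2) * gradSqR φ x
      + 2 * (∑ i, pdR φ x i * pdR b x i) + 2 * (∑ i, pdR φ x i * pdR (fun y => α y * b y) x i)
      - 4 * (b x * ∑ i, pdR φ x i * pdR α x i) := by
  simp only [gradSq, gradSqR, norm_sq_pd hU hφ hα hb, pdR_mul hα hb, Fin.sum_univ_two]
  ring

theorem gradSqR_add_le (hU : ∀ x, U x =
      Complex.exp (Complex.I * (φ x : ℂ)) * (1 + α x + b x * Complex.I)) {x : Pt}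
    (hφ : DifferentiableAt ℝ φ x) (hα : DifferentiableAt ℝ α x) (hb : DifferentiableAt ℝ b x) :
    gradSqR α x + gradSqR b x ≤ 2 * gradSq U x
      + 2 * (gradSqR φ x + (2 * α x + α x ^ 2 + b x ^ 2) * gradSqR φ x) := by
  simp only [gradSq, gradSqR, norm_sq_pd hU hφ hα hb, Fin.sum_univ_two]
  nlinarith [sq_nonneg (pdR α x 0 - 2 * (pdR φ x 0 * b x)),
    sq_nonneg (pdR α x 1 - 2 * (pdR φ x 1 * b x)),
    sq_nonneg (pdR b x 0 + 2 * (pdR φ x 0 * (1 + α x))),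
    sq_nonneg (pdR b x 1 + 2 * (pdR φ x 1 * (1 + α x)))]

theorem gradDiffSq_le (hU : ∀ x, U x =
      Complex.exp (Complex.I * (φ x : ℂ)) * (1 + α x + b x * Complex.I))
    (hu₀ : ∀ x, u₀ x = Complex.exp (Complex.I * (φ x : ℂ))) {x : Pt}
    (hφ : DifferentiableAt ℝ φ x) (hα : DifferentiableAt ℝ α x) (hb : DifferentiableAt ℝ b x) :
    gradDiffSq U u₀ x ≤ 2 * (gradSqR α x + gradSqR b x)
      + 2 * (gradSqR φ x * (α x ^ 2 + b x ^ 2)) := by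
  simp only [gradDiffSq, gradSqR, norm_sq_pd_sub hU hu₀ hφ hα hb, Fin.sum_univ_two]
  nlinarith [sq_nonneg (pdR α x 0 + pdR φ x 0 * b x), sq_nonneg (pdR α x 1 + pdR φ x 1 * b x),
    sq_nonneg (pdR b x 0 - pdR φ x 0 * α x), sq_nonneg (pdR b x 1 - pdR φ x 1 * α x)]

end Pointwise

section Energy
variable {Ω : Set Pt} {φ α b : Pt → ℝ} {U u₀ : Pt → ℂ}

theorem IsReg.memLp_pdR_mul (hΩ : IsOpen Ω) (hbd : Bornology.IsBounded Ω) (hφ : IsReg Ω φ)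
    {g : Pt → ℝ} (hg : MemLp g 2 (volume.restrict Ω)) (i : Fin 2) :
    MemLp (fun x => pdR φ x i * g x) 2 (volume.restrict Ω) := by
  obtain ⟨M, hM⟩ := hφ.exists_bound_pdR hΩ hbd
  refine hg.of_le_mul (c := M) ((hφ.memLp_pdR hΩ hbd i).1.mul hg.1)
    ((ae_restrict_iff' hΩ.measurableSet).2 (ae_of_all _ fun x hx => ?_))
  rw [norm_mul]
  exact mul_le_mul_of_nonneg_right (hM x hx i) (norm_nonneg _)

theorem IsReg.integrableOn_inner (hΩ : IsOpen Ω) (hbd : Bornology.IsBounded Ω) (hφ : IsReg Ω φ)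
    (hα : IsReg Ω α) : IntegrableOn (fun x => ∑ i, pdR φ x i * pdR α x i) Ω :=
  integrable_finsetSum _ fun i _ =>
    (hφ.memLp_pdR hΩ hbd i).integrable_mul (hα.memLp_pdR hΩ hbd i)

theorem IsReg.integrableOn_mul_inner (hΩ : IsOpen Ω) (hbd : Bornology.IsBounded Ω)
    (hφ : IsReg Ω φ) (hα : IsReg Ω α) (hb : IsReg Ω b) :
    IntegrableOn (fun x => b x * ∑ i, pdR φ x i * pdR α x i) Ω := by
  simp only [Finset.mul_sum]
  exact integrable_finsetSum _ fun i _ =>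
    (hb.memLp hΩ hbd).integrable_mul (hφ.memLp_pdR_mul hΩ hbd (hα.memLp_pdR hΩ hbd i) i)

theorem IsReg.integrableOn_mul_gradSqR (hΩ : IsOpen Ω) (hbd : Bornology.IsBounded Ω)
    (hφ : IsReg Ω φ) {g : Pt → ℝ} (hg : MemLp g 2 (volume.restrict Ω)) :
    IntegrableOn (fun x => g x * gradSqR φ x) Ω := by
  simp only [gradSqR, Finset.mul_sum, sq]
  exact integrable_finsetSum _ fun i _ =>
    hg.integrable_mul (hφ.memLp_pdR_mul hΩ hbd (hφ.memLp_pdR hΩ hbd i) i)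

theorem IsReg.memLp_constraint (hΩ : IsOpen Ω) (hbd : Bornology.IsBounded Ω)
    (hα : IsReg Ω α) (hb : IsReg Ω b) :
    MemLp (fun x => 2 * α x + α x ^ 2 + b x ^ 2) 2 (volume.restrict Ω) := by
  simp only [sq]
  exact (((hα.memLp hΩ hbd).const_mul 2).add ((hα.mul hα).memLp hΩ hbd)).add
    ((hb.mul hb).memLp hΩ hbd)

/-- Energy identity for `U = exp(iφ) (1 + α + ib)`. -/
theorem integral_gradSq_eq (hΩ : IsOpen Ω) (hbd : Bornology.IsBounded Ω) (hφ : IsReg Ω φ)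
    (hharm : ∀ x ∈ Ω, lapR φ x = 0) (hα : IsReg₀ Ω α) (hb : IsReg₀ Ω b)
    (hU : ∀ x, U x = Complex.exp (Complex.I * (φ x : ℂ)) * (1 + α x + b x * Complex.I)) :
    IntegrableOn (gradSq U) Ω ∧ ∫ x in Ω, gradSq U x =
      (∫ x in Ω, gradSqR α x) + (∫ x in Ω, gradSqR b x) + (∫ x in Ω, gradSqR φ x)
      + (∫ x in Ω, (2 * α x + α x ^ 2 + b x ^ 2) * gradSqR φ x)
      - 4 * ∫ x in Ω, b x * ∑ i, pdR φ x i * pdR α x i := by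
  have hαb : IsReg₀ Ω (fun x => α x * b x) :=
    ⟨hα.1.mul hb.1, fun x hx => by simp [hα.eq_zero x hx]⟩
  have i1 := hα.1.integrableOn_gradSqR hΩ hbd
  have i2 := hb.1.integrableOn_gradSqR hΩ hbd
  have i3 := hφ.integrableOn_gradSqR hΩ hbd
  have i4 := hφ.integrableOn_mul_gradSqR hΩ hbd (hα.1.memLp_constraint hΩ hbd hb.1)
  have i5 := (IsReg.integrableOn_inner hΩ hbd hφ hb.1).const_mul 2
  have i6 := (IsReg.integrableOn_inner hΩ hbd hφ hαb.1).const_mul 2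
  have i7 := (IsReg.integrableOn_mul_inner hΩ hbd hφ hα.1 hb.1).const_mul 4
  have j2 := i1.fun_add i2
  have j3 := j2.fun_add i3
  have j4 := j3.fun_add i4
  have j5 := j4.fun_add i5
  have j6 := j5.fun_add i6
  have e : Set.EqOn (gradSq U) _ Ω := fun x hx => gradSq_eq hU (hφ.differentiableAt hΩ hx)
    (hα.1.differentiableAt hΩ hx) (hb.1.differentiableAt hΩ hx)
  refine ⟨IntegrableOn.congr_fun (j6.sub i7) (fun x hx => (e hx).symm) hΩ.measurableSet, ?_⟩
  rw [setIntegral_congr_fun hΩ.measurableSet e, integral_sub j6 i7, integral_add j5 i6,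
    integral_add j4 i5, integral_add j3 i4, integral_add j2 i3, integral_add i1 i2,
    integral_const_mul, integral_const_mul, integral_const_mul,
    integral_inner_grad_eq_zero hΩ hbd hφ hharm hb,
    integral_inner_grad_eq_zero hΩ hbd hφ hharm hαb]
  ring

end Energy

theorem gradSqR_le {h : Pt → ℝ} {x : Pt} {M : ℝ} (hM : ∀ i, |pdR h x i| ≤ M) :
    gradSqR h x ≤ 2 * M ^ 2 := by
  have := fun i => sq_le_sq' (neg_le_of_abs_le (hM i)) (le_of_abs_le (hM i))
  simp only [gradSqR, Fin.sum_univ_two]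
  linarith [this 0, this 1]

/-- If the energies of `U i` stay bounded and `|U i| → 1` in `L⁴`, then the excess energy of `U i`
over the harmonic map `u₀` is asymptotic to a quantity controlling `‖U i - u₀‖` in `H¹`. -/
theorem exists_energy_excess {ι : Type*} {l : Filter ι} [l.IsCountablyGenerated] {Ω : Set Pt}
    (hΩ : IsOpen Ω) (hne : Ω.Nonempty) (hbd : Bornology.IsBounded Ω)
    (hstar : ∃ x₀, StarConvex ℝ x₀ Ω) {φ : Pt → ℝ} (hφ : IsReg Ω φ)
    (hharm : ∀ x ∈ Ω, lapR φ x = 0) {u₀ : Pt → ℂ}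
    (hu₀ : ∀ x, u₀ x = Complex.exp (Complex.I * (φ x : ℂ))) {U : ι → Pt → ℂ}
    (hU1 : ∀ n, ContDiffOn ℝ 1 (U n) (closure Ω)) (hU2 : ∀ n, ContDiffOn ℝ 2 (U n) Ω)
    (hUb : ∀ n, ∀ x ∈ frontier Ω, U n x = u₀ x) {C : ℝ}
    (hC : ∀ᶠ n in l, ∫ x in Ω, gradSq (U n) x ≤ C)
    (hL : Tendsto (fun n => ∫ x in Ω, (1 - ‖U n x‖ ^ 2) ^ 2) l (𝓝 0)) :
    ∃ (D : ι → ℝ) (K : ℝ), (∀ n, 0 ≤ D n) ∧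
      Tendsto (fun n => (∫ x in Ω, gradSq (U n) x) - (∫ x in Ω, gradSq u₀ x) - D n) l (𝓝 0) ∧
      (∀ n, ∫ x in Ω, ‖U n x - u₀ x‖ ^ 2 ≤ K * D n) ∧
      ∀ n, ∫ x in Ω, gradDiffSq (U n) u₀ x ≤ K * D n := by
  have hfin := isFiniteMeasure_restrict hbd
  choose α b hα hb hU using fun n =>
    exists_isReg₀_decomposition hφ (hU1 n) (hU2 n) fun x hx => (hUb n x hx).trans (hu₀ x)
  obtain ⟨Cp, hCp0, hCp⟩ := IsReg₀.exists_poincare hΩ hbd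
  obtain ⟨M, hM⟩ := hφ.exists_bound_pdR hΩ hbd
  have hφM : ∀ x ∈ Ω, gradSqR φ x ≤ 2 * M ^ 2 := fun x hx => gradSqR_le (hM x hx)
  set D : ι → ℝ := fun n => (∫ x in Ω, gradSqR (α n) x) + ∫ x in Ω, gradSqR (b n) x with hD
  have g0 : ∀ h : Pt → ℝ, 0 ≤ ∫ x in Ω, gradSqR h x := fun h =>
    integral_nonneg fun x => gradSqR_nonneg h x
  have hD0 : ∀ n, 0 ≤ D n := fun n => add_nonneg (g0 _) (g0 _)
  have iα := fun n => (hα n).1.integrableOn_gradSqR hΩ hbd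
  have ib := fun n => (hb n).1.integrableOn_gradSqR hΩ hbd
  have hDn : ∀ n, D n = ∫ x in Ω, (gradSqR (α n) x + gradSqR (b n) x) := fun n =>
    (integral_add (iα n) (ib n)).symm
  have iφ := hφ.integrableOn_gradSqR hΩ hbd
  have mα := fun n => (hα n).1.memLp hΩ hbd
  have mb := fun n => (hb n).1.memLp hΩ hbd
  have dφ := fun x (hx : x ∈ Ω) => hφ.differentiableAt hΩ hx
  have dα := fun n x (hx : x ∈ Ω) => (hα n).1.differentiableAt hΩ hx
  have db := fun n x (hx : x ∈ Ω) => (hb n).1.differentiableAt hΩ hx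
  have mc := fun n => (hα n).1.memLp_constraint hΩ hbd (hb n).1
  have i4 := fun n => hφ.integrableOn_mul_gradSqR hΩ hbd (mc n)
  have energy := fun n => integral_gradSq_eq hΩ hbd hφ hharm (hα n) (hb n) (hU n)
  have hc : Tendsto (fun n => ∫ x in Ω, |2 * α n x + α n x ^ 2 + b n x ^ 2|) l (𝓝 0) := by
    refine tendsto_integral_abs_zero mc (hL.congr fun n => ?_)
    refine integral_congr_ae (ae_of_all _ fun x => ?_)
    simp only [norm_sq_eq (hU n)]
    ring
  have hF : Tendsto (fun n => ∫ x in Ω, (2 * α n x + α n x ^ 2 + b n x ^ 2) * gradSqR φ x) l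
      (𝓝 0) := by
    have t := hc.mul_const (2 * M ^ 2)
    rw [zero_mul] at t
    refine squeeze_zero_norm (fun n => (norm_integral_le_integral_norm _).trans ?_) t
    rw [← integral_mul_const]
    refine setIntegral_mono_on (i4 n).norm
      (((mc n).integrable (by norm_num)).abs.mul_const _) hΩ.measurableSet fun x hx => ?_
    rw [norm_mul, Real.norm_of_nonneg (gradSqR_nonneg φ x)]
    exact mul_le_mul_of_nonneg_left (hφM x hx) (abs_nonneg _)
  obtain ⟨B, hB⟩ : ∃ B, ∀ᶠ n in l, D n ≤ B := by
    refine ⟨2 * C + 2 * ((∫ x in Ω, gradSqR φ x) + 1), ?_⟩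
    filter_upwards [hC, hF.eventually_le_const zero_lt_one] with n h1 h2
    have h3 : D n ≤ 2 * (∫ x in Ω, gradSq (U n) x) + 2 * ((∫ x in Ω, gradSqR φ x)
        + ∫ x in Ω, (2 * α n x + α n x ^ 2 + b n x ^ 2) * gradSqR φ x) := by
      rw [hDn, ← integral_add iφ (i4 n), ← integral_const_mul,
        ← integral_const_mul,
        ← integral_add ((energy n).1.const_mul 2) ((iφ.fun_add (i4 n)).const_mul 2)]
      exact setIntegral_mono_on ((iα n).fun_add (ib n))
        (((energy n).1.const_mul 2).fun_add ((iφ.fun_add (i4 n)).const_mul 2)) hΩ.measurableSet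
        fun x hx => gradSqR_add_le (hU n) (dφ x hx) (dα n x hx) (db n x hx)
    linarith
  have hG : Tendsto (fun n => ∫ x in Ω, b n x * ∑ i, pdR φ x i * pdR (α n) x i) l (𝓝 0) := by
    refine tendsto_of_subseq_tendsto fun ns hns => ?_
    obtain ⟨N, hN⟩ := eventually_atTop.1 (hns.eventually hB)
    have hN' := fun n : ℕ => hN (n + N) (Nat.le_add_left N n)
    obtain ⟨σ, -, t⟩ := exists_subseq_tendsto_inner_grad (α := fun n => α (ns (n + N)))
      (b := fun n => b (ns (n + N))) (C := B) hΩ hne hbd hstar hφ hharm (fun n => hα _)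
      (fun n => hb _) (fun n => (le_add_of_nonneg_right (g0 _)).trans (hN' n))
      (fun n => (le_add_of_nonneg_left (g0 _)).trans (hN' n))
      ((hc.comp hns).comp (tendsto_add_atTop_nat N))
    exact ⟨fun n => σ n + N, t⟩
  have hP : ∀ n, ∫ x in Ω, (α n x ^ 2 + b n x ^ 2) ≤ Cp * D n := fun n => by
    rw [integral_add (mα n).integrable_sq (mb n).integrable_sq, hD, mul_add]
    exact add_le_add (hCp _ (hα n)) (hCp _ (hb n))
  refine ⟨D, Cp + 2 + 4 * M ^ 2 * Cp, hD0, ?_, fun n => ?_, fun n => ?_⟩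
  · have t := hF.sub (hG.const_mul 4)
    simp only [mul_zero, sub_zero] at t
    refine t.congr fun n => ?_
    have e : ∫ x in Ω, gradSq u₀ x = ∫ x in Ω, gradSqR φ x :=
      setIntegral_congr_fun hΩ.measurableSet fun x hx => gradSq_exp hu₀ (dφ x hx)
    rw [(energy n).2, e, hD]
    ring
  · simp only [norm_sq_sub_eq (hU n) hu₀]
    have : 0 ≤ (2 + 4 * M ^ 2 * Cp) * D n := mul_nonneg (by positivity) (hD0 n)
    linarith [hP n]
  · have i5 : IntegrableOn (fun x => α n x ^ 2 + b n x ^ 2) Ω :=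
      (mα n).integrable_sq.add (mb n).integrable_sq
    have h1 : ∫ x in Ω, gradDiffSq (U n) u₀ x ≤
        2 * D n + 2 * (2 * M ^ 2 * ∫ x in Ω, (α n x ^ 2 + b n x ^ 2)) := by
      rw [hDn, ← integral_const_mul, ← integral_const_mul,
        ← integral_const_mul, ← integral_add (((iα n).fun_add (ib n)).const_mul 2)
        ((i5.const_mul _).const_mul _)]
      refine integral_mono_of_nonneg (ae_of_all _ fun x => Finset.sum_nonneg fun i _ => sq_nonneg _)
        ((((iα n).fun_add (ib n)).const_mul 2).fun_add ((i5.const_mul _).const_mul _))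
        ((ae_restrict_iff' hΩ.measurableSet).2 (ae_of_all _ fun x hx => ?_))
      refine (gradDiffSq_le (hU n) hu₀ (dφ x hx) (dα n x hx) (db n x hx)).trans ?_
      have := mul_le_mul_of_nonneg_right (hφM x hx)
        (add_nonneg (sq_nonneg (α n x)) (sq_nonneg (b n x)))
      linarith
    have h2 := mul_le_mul_of_nonneg_left (hP n) (by positivity : 0 ≤ 4 * M ^ 2)
    have h3 := mul_nonneg hCp0 (hD0 n)
    linarith

theorem ContinuousOn.integrableOn_of_isBounded {Ω : Set Pt} (hbd : Bornology.IsBounded Ω)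
    {f : Pt → ℝ} (hf : ContinuousOn f (closure Ω)) : IntegrableOn f Ω :=
  (hf.integrableOn_compact hbd.isCompact_closure).mono_set subset_closure

theorem integrableOn_gradSq_exp {Ω : Set Pt} (hΩ : IsOpen Ω) (hbd : Bornology.IsBounded Ω)
    {φ : Pt → ℝ} (hφ : IsReg Ω φ) {u₀ : Pt → ℂ}
    (hu₀ : ∀ x, u₀ x = Complex.exp (Complex.I * (φ x : ℂ))) : IntegrableOn (gradSq u₀) Ω :=
  (hφ.integrableOn_gradSqR hΩ hbd).congr_fun
    (fun _ hx => (gradSq_exp hu₀ (hφ.differentiableAt hΩ hx)).symm) hΩ.measurableSet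

theorem integrableOn_gradSq {Ω : Set Pt} (hΩ : IsOpen Ω) (hbd : Bornology.IsBounded Ω)
    {φ : Pt → ℝ} (hφ : IsReg Ω φ) (hharm : ∀ x ∈ Ω, lapR φ x = 0) {u₀ U : Pt → ℂ}
    (hu₀ : ∀ x, u₀ x = Complex.exp (Complex.I * (φ x : ℂ)))
    (hU1 : ContDiffOn ℝ 1 U (closure Ω)) (hU2 : ContDiffOn ℝ 2 U Ω)
    (hUb : ∀ x ∈ frontier Ω, U x = u₀ x) : IntegrableOn (gradSq U) Ω := by
  obtain ⟨α, b, hα, hb, hU⟩ :=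
    exists_isReg₀_decomposition hφ hU1 hU2 fun x hx => (hUb x hx).trans (hu₀ x)
  exact (integral_gradSq_eq hΩ hbd hφ hharm hα hb hU).1

/-- Both moduli tend to one in `L⁴` when the potential term tends to zero. -/
theorem tendsto_integral_one_sub_norm_sq {ι : Type*} {l : Filter ι} {Ω : Set Pt}
    (hbd : Bornology.IsBounded Ω) {u v : ι → Pt → ℂ} (hu : ∀ n, ContinuousOn (u n) (closure Ω))
    (hv : ∀ n, ContinuousOn (v n) (closure Ω))
    (h : Tendsto (fun n => ∫ x in Ω,
      ((2 - ‖u n x‖ ^ 2 - ‖v n x‖ ^ 2) ^ 2 + (1 - ‖u n x‖ ^ 2) ^ 2)) l (𝓝 0)) :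
    Tendsto (fun n => ∫ x in Ω, (1 - ‖u n x‖ ^ 2) ^ 2) l (𝓝 0) ∧
      Tendsto (fun n => ∫ x in Ω, (1 - ‖v n x‖ ^ 2) ^ 2) l (𝓝 0) := by
  have hi : ∀ n, IntegrableOn (fun x =>
      (2 - ‖u n x‖ ^ 2 - ‖v n x‖ ^ 2) ^ 2 + (1 - ‖u n x‖ ^ 2) ^ 2) Ω := fun n => by
    refine ContinuousOn.integrableOn_of_isBounded hbd ?_
    have := hu n
    have := hv n
    fun_prop
  refine ⟨squeeze_zero (fun n => integral_nonneg fun x => sq_nonneg _) (fun n => ?_) h,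
    squeeze_zero (fun n => integral_nonneg fun x => sq_nonneg _) (fun n => ?_)
      (by simpa using h.const_mul 2)⟩
  · refine integral_mono_of_nonneg (ae_of_all _ fun x => sq_nonneg _) (hi n) (ae_of_all _ fun x => ?_)
    exact le_add_of_nonneg_left (sq_nonneg _)
  · rw [← integral_const_mul]
    refine integral_mono_of_nonneg (ae_of_all _ fun x => sq_nonneg _) ((hi n).const_mul 2)
      (ae_of_all _ fun x => ?_)
    nlinarith [sq_nonneg ((2 - ‖u n x‖ ^ 2 - ‖v n x‖ ^ 2) + (1 - ‖u n x‖ ^ 2))]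

/-- Theorem 1.3 (i): for the non-symmetric two-component system, if the Dirichlet
energies are eventually bounded above by `C₃ ≤ (1/2)∫(|∇u₀|² + |∇v₀|²)`, then equality
holds and `(u_ε, v_ε) → (u₀, v₀)` in `H¹(Ω) × H¹(Ω)`. -/
theorem stmt13
    (Ω : Set Pt) (hΩo : IsOpen Ω) (hΩne : Ω.Nonempty) (hΩconn : IsConnected Ω)
    (hΩbdd : Bornology.IsBounded Ω)
    (hstar : ∃ x₀, StarConvex ℝ x₀ Ω)
    (g₁ g₂ : Pt → ℂ)
    (hg₁ : ∀ x ∈ frontier Ω, ‖g₁ x‖ = 1) (hg₂ : ∀ x ∈ frontier Ω, ‖g₂ x‖ = 1)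
    (φ ψ : Pt → ℝ)
    (hφ1 : ContDiffOn ℝ 1 φ (closure Ω)) (hφ2 : ContDiffOn ℝ 2 φ Ω)
    (hφharm : ∀ x ∈ Ω, lapR φ x = 0)
    (hψ1 : ContDiffOn ℝ 1 ψ (closure Ω)) (hψ2 : ContDiffOn ℝ 2 ψ Ω)
    (hψharm : ∀ x ∈ Ω, lapR ψ x = 0)
    (u₀ v₀ : Pt → ℂ)
    (hu₀ : ∀ x, u₀ x = Complex.exp (Complex.I * (φ x : ℂ)))
    (hv₀ : ∀ x, v₀ x = Complex.exp (Complex.I * (ψ x : ℂ)))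
    (hu₀b : ∀ x ∈ frontier Ω, u₀ x = g₁ x)
    (hv₀b : ∀ x ∈ frontier Ω, v₀ x = g₂ x)
    (u v : ℝ → Pt → ℂ)
    (hu1 : ∀ ε > 0, ContDiffOn ℝ 1 (u ε) (closure Ω))
    (hu2 : ∀ ε > 0, ContDiffOn ℝ 2 (u ε) Ω)
    (hv1 : ∀ ε > 0, ContDiffOn ℝ 1 (v ε) (closure Ω))
    (hv2 : ∀ ε > 0, ContDiffOn ℝ 2 (v ε) Ω)
    (hGLu : ∀ ε > 0, ∀ x ∈ Ω,
      -(lap (u ε) x) =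
        ((ε ^ 2 : ℝ) : ℂ)⁻¹ * u ε x * ((2 - ‖u ε x‖ ^ 2 - ‖v ε x‖ ^ 2 : ℝ) : ℂ) +
          ((ε ^ 2 : ℝ) : ℂ)⁻¹ * u ε x * ((1 - ‖u ε x‖ ^ 2 : ℝ) : ℂ))
    (hGLv : ∀ ε > 0, ∀ x ∈ Ω,
      -(lap (v ε) x) =
        ((ε ^ 2 : ℝ) : ℂ)⁻¹ * v ε x * ((2 - ‖u ε x‖ ^ 2 - ‖v ε x‖ ^ 2 : ℝ) : ℂ))
    (hub : ∀ ε > 0, ∀ x ∈ frontier Ω, u ε x = g₁ x)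
    (hvb : ∀ ε > 0, ∀ x ∈ frontier Ω, v ε x = g₂ x)
    (hpoho : ∃ γ₂ > 0, ∀ᶠ ε in 𝓝[>] (0 : ℝ),
      (ε ^ 2)⁻¹ * (∫ x in Ω,
        ((2 - ‖u ε x‖ ^ 2 - ‖v ε x‖ ^ 2) ^ 2 + (1 - ‖u ε x‖ ^ 2) ^ 2)) ≤ γ₂)
    (C₃ : ℝ)
    (hC₃a : ∀ᶠ ε in 𝓝[>] (0 : ℝ),
      (1 / 2) * (∫ x in Ω, (gradSq (u ε) x + gradSq (v ε) x)) ≤ C₃)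
    (hC₃b : C₃ ≤ (1 / 2) * ∫ x in Ω, (gradSq u₀ x + gradSq v₀ x)) :
    C₃ = (1 / 2) * (∫ x in Ω, (gradSq u₀ x + gradSq v₀ x)) ∧
      Tendsto (fun ε => ∫ x in Ω, ‖u ε x - u₀ x‖ ^ 2) (𝓝[>] (0 : ℝ)) (𝓝 0) ∧
      Tendsto (fun ε => ∫ x in Ω, gradDiffSq (u ε) u₀ x) (𝓝[>] (0 : ℝ)) (𝓝 0) ∧
      Tendsto (fun ε => ∫ x in Ω, ‖v ε x - v₀ x‖ ^ 2) (𝓝[>] (0 : ℝ)) (𝓝 0) ∧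
      Tendsto (fun ε => ∫ x in Ω, gradDiffSq (v ε) v₀ x) (𝓝[>] (0 : ℝ)) (𝓝 0) := by
  have hφ : IsReg Ω φ := ⟨hφ1, hφ2⟩
  have hψ : IsReg Ω ψ := ⟨hψ1, hψ2⟩
  set l : Filter (Set.Ioi (0 : ℝ)) := comap Subtype.val (𝓝[>] (0 : ℝ)) with hl
  have hrange : Set.range (Subtype.val : Set.Ioi (0 : ℝ) → ℝ) ∈ 𝓝[>] (0 : ℝ) := by
    rw [Subtype.range_val]
    exact self_mem_nhdsWithin
  have hlne : l.NeBot := NeBot.comap_of_range_mem inferInstance hrange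
  have hle : Tendsto (Subtype.val : Set.Ioi (0 : ℝ) → ℝ) l (𝓝[>] (0 : ℝ)) := tendsto_comap
  have hlift : ∀ {f : ℝ → ℝ}, Tendsto (fun n : Set.Ioi (0 : ℝ) => f n) l (𝓝 0) →
      Tendsto f (𝓝[>] (0 : ℝ)) (𝓝 0) := fun h => (tendsto_comap'_iff hrange).1 h
  have hpot : Tendsto (fun n : Set.Ioi (0 : ℝ) => ∫ x in Ω,
      ((2 - ‖u n x‖ ^ 2 - ‖v n x‖ ^ 2) ^ 2 + (1 - ‖u n x‖ ^ 2) ^ 2)) l (𝓝 0) := by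
    obtain ⟨γ, -, hγ⟩ := hpoho
    have t0 : Tendsto (fun ε : ℝ => γ * ε ^ 2) (𝓝[>] (0 : ℝ)) (𝓝 0) := by
      have : Continuous fun ε : ℝ => γ * ε ^ 2 := by fun_prop
      simpa using (this.tendsto 0).mono_left nhdsWithin_le_nhds
    refine squeeze_zero' (Eventually.of_forall fun n => integral_nonneg fun x => by positivity)
      ?_ (t0.comp hle)
    filter_upwards [hle.eventually hγ] with n hn
    have hn0 : (0 : ℝ) < (n : ℝ) ^ 2 := pow_pos n.2 2
    rw [inv_mul_le_iff₀ hn0] at hn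
    simpa [mul_comm] using hn
  obtain ⟨hLu, hLv⟩ := tendsto_integral_one_sub_norm_sq hΩbdd
    (fun n : Set.Ioi (0 : ℝ) => (hu1 n n.2).continuousOn) (fun n => (hv1 n n.2).continuousOn) hpot
  have nonneg : ∀ w : Pt → ℂ, 0 ≤ ∫ x in Ω, gradSq w x := fun w =>
    integral_nonneg fun x => Finset.sum_nonneg fun i _ => sq_nonneg _
  have split : ∀ n : Set.Ioi (0 : ℝ), ∫ x in Ω, (gradSq (u n) x + gradSq (v n) x) =
      (∫ x in Ω, gradSq (u n) x) + ∫ x in Ω, gradSq (v n) x := fun n =>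
    integral_add
      (integrableOn_gradSq hΩo hΩbdd hφ hφharm hu₀ (hu1 n n.2) (hu2 n n.2)
        fun x hx => (hub n n.2 x hx).trans (hu₀b x hx).symm)
      (integrableOn_gradSq hΩo hΩbdd hψ hψharm hv₀ (hv1 n n.2) (hv2 n n.2)
        fun x hx => (hvb n n.2 x hx).trans (hv₀b x hx).symm)
  have split₀ : ∫ x in Ω, (gradSq u₀ x + gradSq v₀ x) =
      (∫ x in Ω, gradSq u₀ x) + ∫ x in Ω, gradSq v₀ x :=
    integral_add (integrableOn_gradSq_exp hΩo hΩbdd hφ hu₀)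
      (integrableOn_gradSq_exp hΩo hΩbdd hψ hv₀)
  have hE : ∀ᶠ n : Set.Ioi (0 : ℝ) in l,
      (∫ x in Ω, gradSq (u n) x) + (∫ x in Ω, gradSq (v n) x) ≤ 2 * C₃ := by
    filter_upwards [hle.eventually hC₃a] with n hn
    rw [split] at hn
    linarith
  obtain ⟨Du, Ku, hDu0, tu, hu, hu'⟩ := exists_energy_excess (C := 2 * C₃) hΩo hΩne hΩbdd hstar hφ
    hφharm hu₀ (fun n : Set.Ioi (0 : ℝ) => hu1 n n.2) (fun n => hu2 n n.2)
    (fun n x hx => (hub n n.2 x hx).trans (hu₀b x hx).symm)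
    (hE.mono fun n hn => (le_add_of_nonneg_right (nonneg _)).trans hn) hLu
  obtain ⟨Dv, Kv, hDv0, tv, hv, hv'⟩ := exists_energy_excess (C := 2 * C₃) hΩo hΩne hΩbdd hstar hψ
    hψharm hv₀ (fun n : Set.Ioi (0 : ℝ) => hv1 n n.2) (fun n => hv2 n n.2)
    (fun n x hx => (hvb n n.2 x hx).trans (hv₀b x hx).symm)
    (hE.mono fun n hn => (le_add_of_nonneg_left (nonneg _)).trans hn) hLv
  rw [split₀] at hC₃b ⊢
  have t := tu.add tv
  rw [add_zero] at t
  have hge : 0 ≤ 2 * C₃ - ((∫ x in Ω, gradSq u₀ x) + ∫ x in Ω, gradSq v₀ x) := by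
    refine le_of_tendsto t (hE.mono fun n hn => ?_)
    linarith [hDu0 n, hDv0 n]
  have hDu : Tendsto Du l (𝓝 0) := by
    refine squeeze_zero' (Eventually.of_forall hDu0) (hE.mono fun n hn => ?_)
      (by simpa using t.neg)
    linarith [hDv0 n]
  have hDv : Tendsto Dv l (𝓝 0) := by
    refine squeeze_zero' (Eventually.of_forall hDv0) (hE.mono fun n hn => ?_)
      (by simpa using t.neg)
    linarith [hDu0 n]
  have tKu : Tendsto (fun n => Ku * Du n) l (𝓝 0) := by simpa using hDu.const_mul Ku
  have tKv : Tendsto (fun n => Kv * Dv n) l (𝓝 0) := by simpa using hDv.const_mul Kv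
  have pos : ∀ w w₀ : Pt → ℂ, 0 ≤ ∫ x in Ω, gradDiffSq w w₀ x := fun w w₀ =>
    integral_nonneg fun x => Finset.sum_nonneg fun i _ => sq_nonneg _
  have pos' : ∀ w w₀ : Pt → ℂ, 0 ≤ ∫ x in Ω, ‖w x - w₀ x‖ ^ 2 := fun w w₀ =>
    integral_nonneg fun x => sq_nonneg _
  exact ⟨by linarith, hlift (squeeze_zero (fun n => pos' _ _) hu tKu),
    hlift (squeeze_zero (fun n => pos _ _) hu' tKu),
    hlift (squeeze_zero (fun n => pos' _ _) hv tKv),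
    hlift (squeeze_zero (fun n => pos _ _) hv' tKv)⟩
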